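/- arXiv:2008.06824 — 2 statements merged into one kernel-verified Lean document; each statement's English description precedes it below -/
import Mathlib

section
/- Let C_ca be the class of unary (k=1) conjunctive queries over a fixed schema S that are c-connected and acyclic. Every q ∈ C_ca is uniquely characterizable with respect to C_ca by a finite set of positive and negative examples each of which is the canonical structure of a query in C_ca; moreover, this set of examples can be constructed in polynomial time. -/
/-- A finite relational structure over a schema `S` (with arity function `ar`)
with `k` distinguished elements. -/
structure PStruct (S : Type) (ar : S → ℕ) (k : ℕ) : Type 1 where
  dom : Type
  finite : Finite dom
  facts : ∀ R : S, Set (Fin (ar R) → dom)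
  dist : Fin k → dom

attribute [instance] PStruct.finite

namespace PStruct

variable {S : Type} {ar : S → ℕ} {k : ℕ}

/-- `h` is a homomorphism from `A` to `B`: it preserves all facts and maps
distinguished elements to corresponding distinguished elements. -/
def IsHom (A B : PStruct S ar k) (h : A.dom → B.dom) : Prop :=
  (∀ (R : S) (t : Fin (ar R) → A.dom), t ∈ A.facts R → (fun i => h (t i)) ∈ B.facts R) ∧
  ∀ i : Fin k, h (A.dist i) = B.dist i

/-- `(A,𝐚) → (B,𝐛)`: a homomorphism exists. -/
def HomTo (A B : PStruct S ar k) : Prop := ∃ h, IsHom A B h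

/-- Homomorphic equivalence. -/
def HomEquiv (A B : PStruct S ar k) : Prop := HomTo A B ∧ HomTo B A

/-- Direct product of two structures with distinguished elements. -/
def prod (A B : PStruct S ar k) : PStruct S ar k where
  dom := A.dom × B.dom
  finite := inferInstance
  facts R := {t | (fun i => (t i).1) ∈ A.facts R ∧ (fun i => (t i).2) ∈ B.facts R}
  dist i := (A.dist i, B.dist i)

/-- The facts of a structure, as a type. -/
def Fact (A : PStruct S ar k) : Type := Σ R : S, {t : Fin (ar R) → A.dom // t ∈ A.facts R}

/-- Occurrences of elements in facts: a fact together with a position in it. -/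
def Occ (A : PStruct S ar k) : Type :=
  Σ R : S, {t : Fin (ar R) → A.dom // t ∈ A.facts R} × Fin (ar R)

def Occ.fact {A : PStruct S ar k} (o : Occ A) : Fact A := ⟨o.1, o.2.1⟩

def Occ.elem {A : PStruct S ar k} (o : Occ A) : A.dom := o.2.1.1 o.2.2

/-- Vertices of the (subdivided) incidence graph: elements, occurrences, and facts.
Each occurrence vertex subdivides one edge of the bipartite incidence multigraph,
so that cycles (resp. connectivity) of the incidence multigraph correspond exactly to
cycles (resp. connectivity) of this simple graph. -/
def IncV (A : PStruct S ar k) : Type := A.dom ⊕ (Occ A ⊕ Fact A)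

/-- The incidence graph of a structure, as a simple graph (with each
element-occurrence-in-a-fact edge of the incidence multigraph subdivided). -/
def incGraph (A : PStruct S ar k) : SimpleGraph (IncV A) where
  Adj v w := ∃ o : Occ A,
    (v = Sum.inl o.elem ∧ w = Sum.inr (Sum.inl o)) ∨
    (w = Sum.inl o.elem ∧ v = Sum.inr (Sum.inl o)) ∨
    (v = Sum.inr (Sum.inl o) ∧ w = Sum.inr (Sum.inr o.fact)) ∨
    (w = Sum.inr (Sum.inl o) ∧ v = Sum.inr (Sum.inr o.fact))
  symm := by
    constructor
    rintro v w ⟨o, h⟩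
    exact ⟨o, by tauto⟩
  loopless := by
    constructor
    rintro v ⟨o, (⟨h1, h2⟩ | ⟨h1, h2⟩ | ⟨h1, h2⟩ | ⟨h1, h2⟩)⟩ <;> rw [h1] at h2 <;>
      first
      | exact Sum.inl_ne_inr h2
      | exact Sum.inl_ne_inr (Sum.inr.inj h2)

/-- A structure is acyclic if its incidence graph is acyclic (Berge acyclicity). -/
def Acyclic (A : PStruct S ar k) : Prop := (incGraph A).IsAcyclic

/-- A structure is c-acyclic if every cycle of its incidence graph passes through
a distinguished element. -/
def CAcyclic (A : PStruct S ar k) : Prop :=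
  ∀ (v : IncV A) (c : (incGraph A).Walk v v), c.IsCycle →
    ∃ i : Fin k, Sum.inl (A.dist i) ∈ c.support

/-- A structure is c-connected if every connected component of its incidence graph
contains a distinguished element. -/
def CConnected (A : PStruct S ar k) : Prop :=
  ∀ v : IncV A, ∃ i : Fin k, (incGraph A).Reachable (Sum.inl (A.dist i)) v

/-- The incidence graph is connected. -/
def IncConnected (A : PStruct S ar k) : Prop := (incGraph A).Connected

/-- The fact graph: vertices are facts, with an edge between distinct facts that
share a non-distinguished element. -/
def factGraph (A : PStruct S ar k) : SimpleGraph (Fact A) where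
  Adj f g := f ≠ g ∧ ∃ b : A.dom, (∀ i, b ≠ A.dist i) ∧ (∃ j, f.2.1 j = b) ∧ (∃ j, g.2.1 j = b)
  symm := by
    constructor
    rintro f g ⟨hne, b, h1, h2, h3⟩
    exact ⟨hne.symm, b, h1, h3, h2⟩
  loopless := by constructor; rintro f ⟨hne, -⟩; exact hne rfl

/-- A structure is fg-connected if its fact graph is connected. -/
def FgConnected (A : PStruct S ar k) : Prop := (factGraph A).Connected

/-- A structure is a core if it admits no homomorphism to a proper substructure,
i.e. every endomorphism is surjective on elements and on facts. -/
def IsCore (A : PStruct S ar k) : Prop :=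
  ∀ h : A.dom → A.dom, IsHom A A h →
    Function.Surjective h ∧
    ∀ (R : S) (t : Fin (ar R) → A.dom), t ∈ A.facts R →
      ∃ s ∈ A.facts R, (fun i => h (s i)) = t

/-- Unique Names Property: the distinguished elements are pairwise distinct. -/
def UNP (A : PStruct S ar k) : Prop := Function.Injective A.dist

/-- A structure is safe if every distinguished element occurs in at least one fact. -/
def Safe (A : PStruct S ar k) : Prop :=
  ∀ i : Fin k, ∃ (R : S) (t : Fin (ar R) → A.dom), t ∈ A.facts R ∧ ∃ j, t j = A.dist i

/-- A structure is (the canonical structure of) a conjunctive query iff every element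
occurs in at least one fact (in particular it is safe). -/
def IsCQ (A : PStruct S ar k) : Prop :=
  ∀ x : A.dom, ∃ (R : S) (t : Fin (ar R) → A.dom), t ∈ A.facts R ∧ ∃ j, t j = x

/-- The size of a structure: its number of facts. -/
noncomputable def size (A : PStruct S ar k) : ℕ := Nat.card (Fact A)

/-- The total size of a set of structures: the sum of (size + 1) over its members. -/
noncomputable def totalSize (F : Set (PStruct S ar k)) : ℕ := ∑ᶠ B ∈ F, (size B + 1)

/-- `F` is a frontier for `A` with respect to the class `C`. -/
def IsFrontier (C : Set (PStruct S ar k)) (A : PStruct S ar k)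
    (F : Set (PStruct S ar k)) : Prop :=
  F.Finite ∧
  (∀ B ∈ F, HomTo B A) ∧
  (∀ B ∈ F, ¬ HomTo A B) ∧
  ∀ C' ∈ C, HomTo C' A → ¬ HomTo A C' → ∃ B ∈ F, HomTo C' B

/-- `D` is a finite duality for `A` with respect to the class `C`. -/
def IsDuality (C : Set (PStruct S ar k)) (A : PStruct S ar k)
    (D : Set (PStruct S ar k)) : Prop :=
  D.Finite ∧ ∀ C' ∈ C, (HomTo A C' ↔ ∀ B ∈ D, ¬ HomTo C' B)

/-- A conjunctive query (given by its canonical structure `Q`) fits the example sets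
`(E⁺, E⁻)`: every example in `E⁺` is positive and every example in `E⁻` is negative.
(By Chandra–Merlin, `(A,𝐚)` is a positive example for `Q` iff `Q → (A,𝐚)`.) -/
def Fits (Q : PStruct S ar k) (Ep Em : Set (PStruct S ar k)) : Prop :=
  (∀ E ∈ Ep, HomTo Q E) ∧ (∀ E ∈ Em, ¬ HomTo Q E)

/-- `(E⁺, E⁻)` uniquely characterizes the CQ `Q` with respect to the class `C` of CQs
(all represented by their canonical structures): `Q` fits, and every member of `C`
that fits is logically equivalent (i.e. homomorphically equivalent) to `Q`. -/
def UniquelyCharacterizes (Ep Em : Set (PStruct S ar k)) (Q : PStruct S ar k)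
    (C : Set (PStruct S ar k)) : Prop :=
  Fits Q Ep Em ∧ ∀ Q' ∈ C, Fits Q' Ep Em → HomEquiv Q Q'

end PStruct

open PStruct


namespace Aux

section graph
variable {V : Type*} {G : SimpleGraph V}

theorem exists_lower (hG : G.IsTree) (u v : V) (h : v ≠ u) :
    ∃ w, G.Adj w v ∧ G.dist u w < G.dist u v := by
  obtain ⟨p, hp⟩ := hG.connected.exists_walk_length_eq_dist u v
  have hn : ¬ p.Nil := fun hn => h hn.eq.symm
  refine ⟨p.penultimate, p.adj_penultimate hn, ?_⟩
  have h1 := G.dist_le p.dropLast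
  have h2 : p.dropLast.length + 1 = p.length := by
    have h3 : p.length ≠ 0 := fun h0 => hn (SimpleGraph.Walk.length_eq_zero_iff.mp h0)
    have h4 : p.dropLast.length = p.length - 1 := by simp
    omega
  omega

theorem unique_lower (hG : G.IsTree) (u v w₁ w₂ : V) (h₁ : G.Adj w₁ v) (h₂ : G.Adj w₂ v)
    (l₁ : G.dist u w₁ < G.dist u v) (l₂ : G.dist u w₂ < G.dist u v) : w₁ = w₂ := by
  have key : ∀ w, G.Adj w v → G.dist u w < G.dist u v →
      ∃ p : G.Walk u v, p.IsPath ∧ p.penultimate = w := by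
    intro w hw l
    obtain ⟨p, hp⟩ := hG.connected.exists_walk_length_eq_dist u w
    refine ⟨p.concat hw, ?_, by simp⟩
    apply SimpleGraph.Walk.isPath_of_length_eq_dist
    have := hG.dist_eq_dist_add_one_of_adj u hw
    simp only [SimpleGraph.Walk.length_concat]
    omega
  obtain ⟨p, hp, rfl⟩ := key w₁ h₁ l₁
  obtain ⟨q, hq, rfl⟩ := key w₂ h₂ l₂
  have := (hG.isAcyclic.subsingleton_path u v).elim ⟨p, hp⟩ ⟨q, hq⟩
  simp only [Subtype.mk.injEq] at this
  rw [this]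

theorem acyclic_of_rank (ρ : V → ℕ)
    (h : ∀ v w₁ w₂, G.Adj v w₁ → G.Adj v w₂ → ρ w₁ ≤ ρ v → ρ w₂ ≤ ρ v → w₁ = w₂) :
    G.IsAcyclic := by
  classical
  intro v c hc
  obtain ⟨m, hm, hmax⟩ := Finset.exists_max_image c.support.toFinset ρ
    ⟨v, by simp⟩
  rw [List.mem_toFinset] at hm
  have hc' := hc.rotate (u := m) hm
  have hs : ∀ w ∈ (c.rotate m hm).support, ρ w ≤ ρ m := by
    intro w hw
    apply hmax
    rw [List.mem_toFinset]
    simpa using hw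
  have hn : ¬ (c.rotate m hm).Nil := hc'.not_nil
  apply hc'.snd_ne_penultimate
  exact h m _ _ ((c.rotate m hm).adj_snd hn) ((c.rotate m hm).adj_penultimate hn).symm
    (hs _ (SimpleGraph.Walk.getVert_mem_support _ _))
    (hs _ (SimpleGraph.Walk.getVert_mem_support _ _))

end graph

variable {S : Type} {ar : S → ℕ}

/-- Occurrences as a sigma type over facts. -/
abbrev FPos (A : PStruct S ar 1) : Type := Σ F : Fact A, Fin (ar F.1)

/-- Combinatorial rooted-tree description of a structure. -/
structure TL (A : PStruct S ar 1) (r : A.dom) (d : A.dom → ℕ) (pp : ∀ F : Fact A, Fin (ar F.1)) :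
    Prop where
  lt : ∀ F j, j ≠ pp F → d (F.2.1 (pp F)) < d (F.2.1 j)
  ex : ∀ e, e ≠ r → ∃ F j, j ≠ pp F ∧ F.2.1 j = e
  uniq : ∀ F j F' j', j ≠ pp F → j' ≠ pp F' → F.2.1 j = F'.2.1 j' →
    (⟨F, j⟩ : FPos A) = ⟨F', j'⟩
  root : ∀ F j, j ≠ pp F → F.2.1 j ≠ r

theorem adj_elem {A : PStruct S ar 1} (F : Fact A) (j : Fin (ar F.1)) :
    (incGraph A).Adj (Sum.inl (F.2.1 j)) (Sum.inr (Sum.inl ⟨F.1, F.2, j⟩)) :=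
  ⟨⟨F.1, F.2, j⟩, Or.inl ⟨rfl, rfl⟩⟩

theorem adj_fact {A : PStruct S ar 1} (F : Fact A) (j : Fin (ar F.1)) :
    (incGraph A).Adj (Sum.inr (Sum.inl ⟨F.1, F.2, j⟩)) (Sum.inr (Sum.inr F)) :=
  ⟨⟨F.1, F.2, j⟩, Or.inr (Or.inr (Or.inl ⟨rfl, rfl⟩))⟩

theorem adj_inl {A : PStruct S ar 1} {e : A.dom} {w : IncV A}
    (h : (incGraph A).Adj (Sum.inl e) w) :
    ∃ (F : Fact A) (j : Fin (ar F.1)), F.2.1 j = e ∧ w = Sum.inr (Sum.inl ⟨F.1, F.2, j⟩) := by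
  obtain ⟨⟨R, t, j⟩, h⟩ := h
  rcases h with ⟨h1, h2⟩ | ⟨h1, h2⟩ | ⟨h1, h2⟩ | ⟨h1, h2⟩
  · exact ⟨⟨R, t⟩, j, (Sum.inl.inj h1).symm, h2⟩
  · cases h2
  · cases h1
  · cases h2

theorem adj_occ {A : PStruct S ar 1} {F : Fact A} {j : Fin (ar F.1)} {w : IncV A}
    (h : (incGraph A).Adj (Sum.inr (Sum.inl ⟨F.1, F.2, j⟩)) w) :
    w = Sum.inl (F.2.1 j) ∨ w = Sum.inr (Sum.inr F) := by
  obtain ⟨o, h⟩ := h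
  rcases h with ⟨h1, h2⟩ | ⟨h1, h2⟩ | ⟨h1, h2⟩ | ⟨h1, h2⟩
  · cases h1
  · left; cases h2; exact h1
  · right; cases h1; exact h2
  · cases h2

theorem adj_inr {A : PStruct S ar 1} {F : Fact A} {w : IncV A}
    (h : (incGraph A).Adj (Sum.inr (Sum.inr F)) w) :
    ∃ j, w = Sum.inr (Sum.inl ⟨F.1, F.2, j⟩) := by
  obtain ⟨⟨R, t, j⟩, h⟩ := h
  rcases h with ⟨h1, h2⟩ | ⟨h1, h2⟩ | ⟨h1, h2⟩ | ⟨h1, h2⟩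
  · cases h1
  · cases h2
  · cases h1
  · cases h2; exact ⟨j, h1⟩

theorem TL.reach {A : PStruct S ar 1} {r d pp} (h : TL A r d pp) (v : IncV A) :
    (incGraph A).Reachable (Sum.inl r) v := by
  have he : ∀ n, ∀ e, d e = n → (incGraph A).Reachable (Sum.inl r) (Sum.inl e) := by
    intro n
    induction n using Nat.strong_induction_on with
    | _ n ih =>
      intro e hn
      by_cases her : e = r
      · subst her; exact SimpleGraph.Reachable.refl _
      · obtain ⟨F, j, hj, rfl⟩ := h.ex e her
        have := ih _ (hn ▸ h.lt F j hj) _ rfl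
        refine this.trans ?_
        refine (adj_elem F (pp F)).reachable.trans ?_
        refine (adj_fact F (pp F)).reachable.trans ?_
        exact ((adj_elem F j).reachable.trans (adj_fact F j).reachable).symm
  rcases v with e | ⟨R, t, j⟩ | F
  · exact he _ e rfl
  · exact (he _ _ rfl).trans (adj_elem ⟨R, t⟩ j).reachable
  · exact (he _ _ rfl).trans ((adj_elem F (pp F)).reachable.trans (adj_fact F (pp F)).reachable)

open Classical in
/-- rank used for acyclicity -/
noncomputable def rank {A : PStruct S ar 1} (d : A.dom → ℕ) (pp : ∀ F : Fact A, Fin (ar F.1)) :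
    IncV A → ℕ
  | Sum.inl e => 4 * d e
  | Sum.inr (Sum.inl o) =>
      4 * d (o.2.1.1 (pp ⟨o.1, o.2.1⟩)) + if o.2.2 = pp ⟨o.1, o.2.1⟩ then 1 else 3
  | Sum.inr (Sum.inr F) => 4 * d (F.2.1 (pp F)) + 2

theorem rank_pp {A : PStruct S ar 1} (d : A.dom → ℕ) (pp : ∀ F : Fact A, Fin (ar F.1)) (F : Fact A) :
    rank d pp (Sum.inr (Sum.inl ⟨F.1, F.2, pp F⟩) : IncV A) = 4 * d (F.2.1 (pp F)) + 1 := by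
  rcases F with ⟨R, t⟩
  simp [rank]

theorem rank_np {A : PStruct S ar 1} (d : A.dom → ℕ) (pp : ∀ F : Fact A, Fin (ar F.1)) (F : Fact A)
    (j : Fin (ar F.1)) (hj : j ≠ pp F) :
    rank d pp (Sum.inr (Sum.inl ⟨F.1, F.2, j⟩) : IncV A) = 4 * d (F.2.1 (pp F)) + 3 := by
  rcases F with ⟨R, t⟩
  simp only [rank]
  rw [if_neg hj]

theorem rank_e {A : PStruct S ar 1} (d : A.dom → ℕ) (pp : ∀ F : Fact A, Fin (ar F.1)) (e : A.dom) :
    rank d pp (Sum.inl e : IncV A) = 4 * d e := rfl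

theorem TL.acyclic {A : PStruct S ar 1} {r d pp} (h : TL A r d pp) : Acyclic A := by
  apply acyclic_of_rank (rank d pp)
  rintro (e | ⟨R, t, j⟩ | F) w₁ w₂ a₁ a₂ l₁ l₂
  · obtain ⟨F, j, rfl, rfl⟩ := adj_inl a₁
    obtain ⟨F', j', hF', rfl⟩ := adj_inl a₂
    have h1 : j ≠ pp F := by
      rintro rfl
      rw [rank_pp, rank_e] at l₁
      omega
    have h2 : j' ≠ pp F' := by
      rintro rfl
      rw [rank_pp, rank_e, ← hF'] at l₂
      omega
    have := h.uniq F j F' j' h1 h2 hF'.symm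
    cases this
    rfl
  · have k := h.lt ⟨R, t⟩ j
    rcases adj_occ (F := ⟨R, t⟩) a₁ with rfl | rfl <;>
    rcases adj_occ (F := ⟨R, t⟩) a₂ with rfl | rfl
    · rfl
    · exfalso
      simp only [rank] at l₁ l₂
      split_ifs at l₁ l₂ with hj
      · omega
      · have := k hj
        simp only at this
        omega
    · exfalso
      simp only [rank] at l₁ l₂
      split_ifs at l₁ l₂ with hj
      · omega
      · have := k hj
        simp only at this
        omega
    · rfl
  · have key : ∀ j, rank d pp (Sum.inr (Sum.inl ⟨F.1, F.2, j⟩) : IncV A) ≤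
        rank d pp (Sum.inr (Sum.inr F) : IncV A) → j = pp F := by
      intro j hj
      by_contra hne
      rw [rank_np _ _ _ _ hne] at hj
      change _ ≤ 4 * d (F.2.1 (pp F)) + 2 at hj
      omega
    obtain ⟨j, rfl⟩ := adj_inr a₁
    obtain ⟨j', rfl⟩ := adj_inr a₂
    rw [key j l₁, key j' l₂]

theorem exists_TL {A : PStruct S ar 1} (hc : CConnected A) (ha : Acyclic A) (r : A.dom) :
    ∃ d pp, TL A r d pp := by
  have hconn : (incGraph A).Connected := by
    have : Nonempty (IncV A) := ⟨Sum.inl r⟩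
    refine SimpleGraph.Connected.mk ?_
    intro u v
    obtain ⟨i, hi⟩ := hc u
    obtain ⟨j, hj⟩ := hc v
    rw [Subsingleton.elim i j] at hi
    exact hi.symm.trans hj
  have hT : (incGraph A).IsTree := ⟨hconn, ha⟩
  set D : IncV A → ℕ := (incGraph A).dist (Sum.inl r) with hD
  have hadj := fun {v w : IncV A} (h : (incGraph A).Adj v w) =>
    hT.dist_eq_dist_add_one_of_adj (Sum.inl r) h
  have hlow := fun v => exists_lower hT (Sum.inl r) v
  have huni := unique_lower hT (Sum.inl r)
  simp only [← hD] at hadj hlow huni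
  have hpp : ∀ F : Fact A, ∃ j : Fin (ar F.1),
      D (Sum.inr (Sum.inl ⟨F.1, F.2, j⟩)) < D (Sum.inr (Sum.inr F)) := by
    intro F
    obtain ⟨w, hw, hl⟩ := hlow (Sum.inr (Sum.inr F)) (by intro h; cases h)
    obtain ⟨j, rfl⟩ := adj_inr hw.symm
    exact ⟨j, hl⟩
  choose pp hpp using hpp
  have hnp : ∀ F j, j ≠ pp F → D (Sum.inr (Sum.inl ⟨F.1, F.2, j⟩)) = D (Sum.inr (Sum.inr F)) + 1 := by
    intro F j hj
    rcases hadj (adj_fact F j) with h | h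
    · exact h
    · exfalso
      apply hj
      have := huni _ _ _ (adj_fact F j) (adj_fact F (pp F)) (by omega) (hpp F)
      cases F
      have h3 := Sum.inl.inj (Sum.inr.inj this)
      simp only at h3
      injection h3 with h4 h5
      exact congrArg Prod.snd h5
  have hne : ∀ F j, j ≠ pp F → D (Sum.inl (F.2.1 j)) = D (Sum.inr (Sum.inl ⟨F.1, F.2, j⟩)) + 1 := by
    intro F j hj
    rcases hadj (adj_elem F j) with h | h
    · exact h
    · exfalso
      have := huni _ _ _ (adj_elem F j) (adj_fact F j).symm (by omega) (by rw [hnp F j hj]; omega)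
      cases this
  have hpe : ∀ F, D (Sum.inl (F.2.1 (pp F))) + 1 = D (Sum.inr (Sum.inl ⟨F.1, F.2, pp F⟩)) := by
    intro F
    obtain ⟨w, hw, hl⟩ := hlow (Sum.inr (Sum.inl ⟨F.1, F.2, pp F⟩)) (by intro h; cases h)
    rcases adj_occ hw.symm with rfl | rfl
    · rcases hadj hw with h | h <;> omega
    · have := hpp F; omega
  refine ⟨fun e => D (Sum.inl e), pp, ?_, ?_, ?_, ?_⟩
  · intro F j hj
    have h1 := hnp F j hj
    have h2 := hne F j hj
    have h3 := hpe F
    have h4 := hpp F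
    show D (Sum.inl (F.2.1 (pp F))) < D (Sum.inl (F.2.1 j))
    omega
  · intro e he
    obtain ⟨w, hw, hl⟩ := hlow (Sum.inl e) (fun h => he (Sum.inl.inj h))
    obtain ⟨F, j, rfl, rfl⟩ := adj_inl hw.symm
    refine ⟨F, j, ?_, rfl⟩
    rintro rfl
    have := hpe F
    omega
  · intro F j F' j' hj hj' hE
    have h1 := hne F j hj
    have h2 := hne F' j' hj'
    have := huni (Sum.inl (F.2.1 j)) _ _ (adj_elem F j).symm (hE ▸ (adj_elem F' j').symm)
      (by omega) (by rw [hE]; omega)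
    rcases F with ⟨R, t⟩
    rcases F' with ⟨R', t'⟩
    have h3 := Sum.inl.inj (Sum.inr.inj this)
    simp only at h3
    cases h3
    rfl
  · intro F j hj h
    have := hne F j hj
    rw [h] at this
    have h0 : D (Sum.inl r) = 0 := SimpleGraph.dist_self
    omega

theorem TL.hom {A B : PStruct S ar 1} {d pp} (h : TL A (A.dist 0) d pp)
    (Z : A.dom → B.dom → Prop) (hr : Z (A.dist 0) (B.dist 0))
    (hs : ∀ (F : Fact A) (b : B.dom), Z (F.2.1 (pp F)) b →
      ∃ s ∈ B.facts F.1, s (pp F) = b ∧ ∀ j, Z (F.2.1 j) (s j)) : HomTo A B := by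
  classical
  have hs' : ∀ (F : Fact A) (b : B.dom), ∃ s : Fin (ar F.1) → B.dom, Z (F.2.1 (pp F)) b →
      s ∈ B.facts F.1 ∧ s (pp F) = b ∧ ∀ j, Z (F.2.1 j) (s j) := by
    intro F b
    by_cases hz : Z (F.2.1 (pp F)) b
    · obtain ⟨s, h1, h2⟩ := hs F b hz
      exact ⟨s, fun _ => ⟨h1, h2⟩⟩
    · exact ⟨fun _ => b, fun h => absurd h hz⟩
  choose s hs' using hs'
  have hex : ∀ e : {e // e ≠ A.dist 0}, ∃ o : FPos A, o.2 ≠ pp o.1 ∧ o.1.2.1 o.2 = e.1 := by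
    intro e
    obtain ⟨F, j, h1, h2⟩ := h.ex e.1 e.2
    exact ⟨⟨F, j⟩, h1, h2⟩
  choose o ho1 ho2 using hex
  have hlt : ∀ e : {e // e ≠ A.dist 0}, d ((o e).1.2.1 (pp (o e).1)) < d e.1 := by
    intro e
    have := h.lt (o e).1 (o e).2 (ho1 e)
    rwa [ho2 e] at this
  have wf : WellFounded (fun a b : A.dom => d a < d b) := (measure d).wf
  let g : A.dom → B.dom := wf.fix (fun e ih =>
    if he : e = A.dist 0 then B.dist 0 else
      s (o ⟨e, he⟩).1 (ih _ (hlt ⟨e, he⟩)) (o ⟨e, he⟩).2)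
  have g0 : g (A.dist 0) = B.dist 0 := by
    show wf.fix _ _ = _
    rw [wf.fix_eq]
    simp
  have g1 : ∀ e (he : e ≠ A.dist 0), g e =
      s (o ⟨e, he⟩).1 (g ((o ⟨e, he⟩).1.2.1 (pp (o ⟨e, he⟩).1))) (o ⟨e, he⟩).2 := by
    intro e he
    show wf.fix _ _ = _
    rw [wf.fix_eq, dif_neg he]
  have gZ : ∀ e, Z e (g e) := by
    intro e
    induction e using wf.induction with
    | _ e ih =>
      by_cases he : e = A.dist 0
      · rw [he, g0]; exact hr
      · rw [g1 e he]
        have h1 := ih _ (hlt ⟨e, he⟩)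
        have h2 := (hs' _ _ h1).2.2 (o ⟨e, he⟩).2
        rwa [ho2 ⟨e, he⟩] at h2
  have gs : ∀ (F : Fact A) j, g (F.2.1 j) = s F (g (F.2.1 (pp F))) j := by
    intro F j
    by_cases hj : j = pp F
    · rw [hj, (hs' F _ (gZ _)).2.1]
    · have he := h.root F j hj
      have := h.uniq F j (o ⟨_, he⟩).1 (o ⟨_, he⟩).2 hj (ho1 _) (ho2 ⟨_, he⟩).symm
      rw [g1 _ he]
      have key : ∀ p q : FPos A, p = q → s p.1 (g (p.1.2.1 (pp p.1))) p.2 =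
          s q.1 (g (q.1.2.1 (pp q.1))) q.2 := by
        rintro p q rfl; rfl
      exact (key _ _ this).symm
  refine ⟨g, ?_, ?_⟩
  · intro R t ht
    have h1 := (hs' ⟨R, t, ht⟩ _ (gZ _)).1
    have h2 : (fun i => g (t i)) = s ⟨R, t, ht⟩ (g (t (pp ⟨R, t, ht⟩))) :=
      funext fun i => gs ⟨R, t, ht⟩ i
    rw [h2]
    exact h1
  · intro i
    rw [Subsingleton.elim i 0]
    exact g0

theorem HomTo.trans {A B C : PStruct S ar 1} (h1 : HomTo A B) (h2 : HomTo B C) : HomTo A C := by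
  obtain ⟨f, hf⟩ := h1
  obtain ⟨g, hg⟩ := h2
  refine ⟨g ∘ f, fun R t ht => hg.1 _ _ (hf.1 _ _ ht), fun i => ?_⟩
  rw [Function.comp, hf.2, hg.2]

/-- image of a fact -/
def mapFact {A B : PStruct S ar 1} {h : A.dom → B.dom} (hh : IsHom A B h) (F : Fact A) : Fact B :=
  ⟨F.1, ⟨fun i => h (F.2.1 i), hh.1 _ _ F.2.2⟩⟩

/-- image of an incidence-graph vertex -/
def incMap {A B : PStruct S ar 1} {h : A.dom → B.dom} (hh : IsHom A B h) : IncV A → IncV B :=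
  Sum.map h (Sum.map
    (fun o => (⟨o.1, ⟨fun i => h (o.2.1.1 i), hh.1 _ _ o.2.1.2⟩, o.2.2⟩ : Occ B)) (mapFact hh))

/-- homs induce graph homs -/
def incHom {A B : PStruct S ar 1} {h : A.dom → B.dom} (hh : IsHom A B h) :
    incGraph A →g incGraph B where
  toFun := incMap hh
  map_rel' := by
    rintro v w ⟨o, h | h | h | h⟩
    · obtain ⟨rfl, rfl⟩ := h
      exact ⟨_, Or.inl ⟨rfl, rfl⟩⟩
    · obtain ⟨rfl, rfl⟩ := h
      exact ⟨_, Or.inr (Or.inl ⟨rfl, rfl⟩)⟩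
    · obtain ⟨rfl, rfl⟩ := h
      exact ⟨_, Or.inr (Or.inr (Or.inl ⟨rfl, rfl⟩))⟩
    · obtain ⟨rfl, rfl⟩ := h
      exact ⟨_, Or.inr (Or.inr (Or.inr ⟨rfl, rfl⟩))⟩

/-- The class of c-connected acyclic CQs. -/
def Ca (Q : PStruct S ar 1) : Prop := IsCQ Q ∧ CConnected Q ∧ Acyclic Q

/-- image of an endomorphism -/
def img (A : PStruct S ar 1) (σ : A.dom → A.dom) : PStruct S ar 1 where
  dom := Set.range σ
  finite := inferInstance
  facts R := {t | ∃ s ∈ A.facts R, ∀ i, σ (s i) = (t i).1}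
  dist i := ⟨σ (A.dist i), ⟨_, rfl⟩⟩

theorem img_incl {A : PStruct S ar 1} {σ : A.dom → A.dom} (h : IsHom A A σ) :
    IsHom (img A σ) A Subtype.val := by
  refine ⟨?_, fun i => h.2 i⟩
  rintro R t ⟨s, hs, hst⟩
  have := h.1 R s hs
  rwa [funext hst] at this

theorem img_proj (A : PStruct S ar 1) (σ : A.dom → A.dom) :
    IsHom A (img A σ) (fun e => ⟨σ e, ⟨_, rfl⟩⟩) :=
  ⟨fun _ t ht => ⟨t, ht, fun _ => rfl⟩, fun _ => rfl⟩

theorem img_Ca {A : PStruct S ar 1} (hA : Ca A) {σ : A.dom → A.dom} (h : IsHom A A σ) :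
    Ca (img A σ) := by
  refine ⟨?_, ?_, ?_⟩
  · rintro ⟨_, e, rfl⟩
    obtain ⟨R, t, ht, j, rfl⟩ := hA.1 e
    exact ⟨R, _, (img_proj A σ).1 R t ht, j, rfl⟩
  · intro v
    have : ∃ u, incHom (img_proj A σ) u = v := by
      have key : ∀ (R : S) (t : Fin (ar R) → (img A σ).dom) (ht : t ∈ (img A σ).facts R),
          ∃ s, ∃ hs : s ∈ A.facts R, t = fun i => ⟨σ (s i), ⟨_, rfl⟩⟩ := by
        rintro R t ⟨s, hs, hst⟩
        exact ⟨s, hs, funext fun i => Subtype.ext (hst i).symm⟩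
      rcases v with ⟨_, e, rfl⟩ | ⟨R, ⟨t, ht⟩, j⟩ | ⟨R, ⟨t, ht⟩⟩
      · exact ⟨Sum.inl e, rfl⟩
      · obtain ⟨s, hs, rfl⟩ := key R t ht
        exact ⟨Sum.inr (Sum.inl ⟨R, ⟨s, hs⟩, j⟩), rfl⟩
      · obtain ⟨s, hs, rfl⟩ := key R t ht
        exact ⟨Sum.inr (Sum.inr ⟨R, ⟨s, hs⟩⟩), rfl⟩
    obtain ⟨u, rfl⟩ := this
    obtain ⟨i, hi⟩ := hA.2.1 u
    exact ⟨i, hi.map (incHom (img_proj A σ))⟩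
  · refine SimpleGraph.IsAcyclic.comap (incHom (img_incl h)) ?_ hA.2.2
    have hinj : ∀ (R : S) (t t' : Fin (ar R) → (img A σ).dom),
        (fun i => (t i).1) = (fun i => (t' i).1) → t = t' := by
      intro R t t' htt
      exact funext fun i => Subtype.ext (congrFun htt i)
    refine Function.Injective.sumMap Subtype.val_injective (Function.Injective.sumMap ?_ ?_)
    · rintro ⟨R, ⟨t, ht⟩, j⟩ ⟨R', ⟨t', ht'⟩, j'⟩ hh
      simp only at hh
      injection hh with h1 h2
      subst h1
      have h2 := eq_of_heq h2
      injection h2 with h3 h4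
      have h5 := hinj R t t' (congrArg Subtype.val h3)
      subst h5 h4
      rfl
    · rintro ⟨R, ⟨t, ht⟩⟩ ⟨R', ⟨t', ht'⟩⟩ hh
      simp only [mapFact] at hh
      injection hh with h1 h2
      subst h1
      have h2 := eq_of_heq h2
      have h5 := hinj R t t' (congrArg Subtype.val h2)
      subst h5
      rfl

instance factFinite [Finite S] (A : PStruct S ar 1) : Finite (Fact A) := by
  unfold PStruct.Fact; infer_instance

/-- endomorphisms act surjectively on stars -/
def StarSurj (Q : PStruct S ar 1) : Prop :=
  ∀ σ, IsHom Q Q σ → ∀ (F : Fact Q) (i : Fin (ar F.1)) (y : Q.dom), F.2.1 i = σ y →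
    ∃ t ∈ Q.facts F.1, (fun j => σ (t j)) = F.2.1 ∧ t i = y

theorem exists_core [Finite S] (Q : PStruct S ar 1) (hQ : Ca Q) :
    ∃ Q0 : PStruct S ar 1, Ca Q0 ∧ HomEquiv Q Q0 ∧ size Q0 ≤ size Q ∧ StarSurj Q0 := by
  classical
  have hex : ∃ n, ∃ Q0 : PStruct S ar 1, Ca Q0 ∧ HomEquiv Q Q0 ∧ size Q0 = n :=
    ⟨_, Q, hQ, ⟨⟨id, fun _ _ h => h, fun _ => rfl⟩, ⟨id, fun _ _ h => h, fun _ => rfl⟩⟩, rfl⟩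
  obtain ⟨Q0, hC, hE, hn⟩ := Nat.find_spec hex
  refine ⟨Q0, hC, hE, ?_, ?_⟩
  · rw [hn]
    exact Nat.find_min' hex
      ⟨Q, hQ, ⟨⟨id, fun _ _ h => h, fun _ => rfl⟩, ⟨id, fun _ _ h => h, fun _ => rfl⟩⟩, rfl⟩
  · intro σ hσ
    have hmin : size Q0 ≤ size (img Q0 σ) := by
      rw [hn]
      refine Nat.find_min' hex ⟨img Q0 σ, img_Ca hC hσ, ⟨?_, ?_⟩, rfl⟩
      · exact HomTo.trans hE.1 ⟨_, img_proj Q0 σ⟩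
      · exact HomTo.trans ⟨_, img_incl hσ⟩ hE.2
    have hsurj : Function.Surjective (mapFact (img_proj Q0 σ)) := by
      rintro ⟨R, t, s, hs, hst⟩
      refine ⟨⟨R, s, hs⟩, ?_⟩
      have : t = fun i => ⟨σ (s i), ⟨_, rfl⟩⟩ := funext fun i => Subtype.ext (hst i).symm
      subst this
      rfl
    have hinj : Function.Injective (mapFact (img_incl hσ)) := by
      rintro ⟨R, t, ht⟩ ⟨R', t', ht'⟩ hh
      simp only [mapFact] at hh
      injection hh with h1 h2
      subst h1
      have h2 := congrArg Subtype.val (eq_of_heq h2)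
      have : t = t' := funext fun i => Subtype.ext (congrFun h2 i)
      subst this
      rfl
    have hbij : Function.Bijective (mapFact (img_incl hσ)) := by
      refine (Nat.bijective_iff_injective_and_card _).2 ⟨hinj, le_antisymm ?_ hmin⟩
      exact Nat.card_le_card_of_injective _ hinj
    have hall : ∀ F : Fact Q0, ∃ F0 : Fact Q0, mapFact hσ F0 = F := by
      intro F
      obtain ⟨G, rfl⟩ := hbij.2 F
      obtain ⟨F0, rfl⟩ := hsurj G
      exact ⟨F0, rfl⟩
    have hσs : Function.Surjective σ := by
      intro e
      obtain ⟨R, t, ht, j, rfl⟩ := hC.1 e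
      obtain ⟨⟨R', t', ht'⟩, hF0⟩ := hall ⟨R, t, ht⟩
      simp only [mapFact] at hF0
      injection hF0 with h1 h2
      subst h1
      have h2 := congrArg Subtype.val (eq_of_heq h2)
      exact ⟨_, congrFun h2 j⟩
    have hσi : Function.Injective σ := Finite.injective_iff_surjective.2 hσs
    rintro ⟨R, t, ht⟩ i y hy
    obtain ⟨⟨R', t', ht'⟩, hF0⟩ := hall ⟨R, t, ht⟩
    simp only [mapFact] at hF0
    injection hF0 with h1 h2
    subst h1
    have h2 := congrArg Subtype.val (eq_of_heq h2)
    refine ⟨t', ht', h2, hσi ?_⟩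
    rw [← hy]
    exact congrFun h2 i

/-- structure given by an indexed family of facts -/
def famS {D Φ : Type} (hD : Finite D) (T : Φ → Σ R : S, Fin (ar R) → D) (r : D) :
    PStruct S ar 1 where
  dom := D
  finite := hD
  facts R := {t | ∃ φ, T φ = ⟨R, t⟩}
  dist _ := r

theorem famS_TL {D Φ : Type} (hD : Finite D) (T : Φ → Σ R : S, Fin (ar R) → D) (r : D)
    (d : D → ℕ) (pp : ∀ φ, Fin (ar (T φ).1))
    (hlt : ∀ φ j, j ≠ pp φ → d ((T φ).2 (pp φ)) < d ((T φ).2 j))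
    (hex : ∀ e, e ≠ r → ∃ φ j, j ≠ pp φ ∧ (T φ).2 j = e)
    (huniq : ∀ φ j φ' j', j ≠ pp φ → j' ≠ pp φ' → (T φ).2 j = (T φ').2 j' →
      (⟨φ, j⟩ : Σ φ, Fin (ar (T φ).1)) = ⟨φ', j'⟩)
    (hroot : ∀ φ j, j ≠ pp φ → (T φ).2 j ≠ r) :
    ∃ pp', TL (famS hD T r) r d pp' := by
  have h : ∀ F : Fact (famS hD T r), ∃ φ, ∃ i : Fin (ar F.1),
      (⟨(T φ).1, (T φ).2, pp φ⟩ : Σ R : S, (Fin (ar R) → D) × Fin (ar R)) = ⟨F.1, F.2.1, i⟩ := by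
    rintro ⟨R, t, φ, hφ⟩
    refine ⟨φ, ?_⟩
    generalize pp φ = i
    revert i
    rw [hφ]
    intro i
    exact ⟨i, rfl⟩
  choose φ pp' h using h
  have key : ∀ (F : Fact (famS hD T r)) (j : Fin (ar F.1)), j ≠ pp' F →
      ∃ j0 : Fin (ar (T (φ F)).1), j0 ≠ pp (φ F) ∧
        (⟨(T (φ F)).1, (T (φ F)).2, j0⟩ : Σ R : S, (Fin (ar R) → D) × Fin (ar R)) =
          ⟨F.1, F.2.1, j⟩ := by
    intro F
    have aux : ∀ X Y : Σ R : S, (Fin (ar R) → D) × Fin (ar R), X = Y →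
        ∀ j, j ≠ Y.2.2 → ∃ j0, j0 ≠ X.2.2 ∧
        (⟨X.1, X.2.1, j0⟩ : Σ R : S, (Fin (ar R) → D) × Fin (ar R)) = ⟨Y.1, Y.2.1, j⟩ := by
      rintro X Y rfl j hj
      exact ⟨j, hj, rfl⟩
    exact aux _ _ (h F)
  let ev : (Σ R : S, (Fin (ar R) → D) × Fin (ar R)) → D := fun X => X.2.1 X.2.2
  have lt' : ∀ (F : Fact (famS hD T r)) (j : Fin (ar F.1)), j ≠ pp' F →
      d (F.2.1 (pp' F)) < d (F.2.1 j) := by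
    intro F j hj
    obtain ⟨j0, h1, h2⟩ := key F j hj
    have e1 : (T (φ F)).2 j0 = F.2.1 j := congrArg ev h2
    have e2 : (T (φ F)).2 (pp (φ F)) = F.2.1 (pp' F) := congrArg ev (h F)
    have h3 := hlt _ _ h1
    rw [e1, e2] at h3
    exact h3
  refine ⟨pp', lt', ?_, ?_, ?_⟩
  · intro e he
    obtain ⟨ψ, j, hj, rfl⟩ := hex e he
    refine ⟨⟨(T ψ).1, (T ψ).2, ψ, rfl⟩, j, ?_, rfl⟩
    intro hjj
    have h1 := hlt ψ j hj
    have h2 := lt' ⟨(T ψ).1, (T ψ).2, ψ, rfl⟩ (pp ψ) (by rw [← hjj]; exact hj.symm)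
    rw [← hjj] at h2
    exact absurd h1 (not_lt.2 h2.le)
  · intro F j F' j' hj hj' hE
    obtain ⟨j0, h1, h2⟩ := key F j hj
    obtain ⟨j0', h1', h2'⟩ := key F' j' hj'
    have e1 : (T (φ F)).2 j0 = F.2.1 j := congrArg ev h2
    have e1' : (T (φ F')).2 j0' = F'.2.1 j' := congrArg ev h2'
    have h3 := huniq _ _ _ _ h1 h1' (by rw [e1, e1']; exact hE)
    have h4 := congrArg (fun p : Σ φ, Fin (ar (T φ).1) =>
      (⟨(T p.1).1, (T p.1).2, p.2⟩ : Σ R : S, (Fin (ar R) → D) × Fin (ar R))) h3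
    simp only at h4
    rw [h2, h2'] at h4
    rcases F with ⟨R, t, ht⟩
    rcases F' with ⟨R', t', ht'⟩
    simp only at h4
    cases h4
    rfl
  · intro F j hj
    obtain ⟨j0, h1, h2⟩ := key F j hj
    have e1 : (T (φ F)).2 j0 = F.2.1 j := congrArg ev h2
    rw [← e1]
    exact hroot _ _ h1

section constr

variable {Q : PStruct S ar 1} (pp : ∀ F : Fact Q, Fin (ar F.1)) (f : Fact Q)

/-- parent element of a fact -/
def par (F : Fact Q) : Q.dom := F.2.1 (pp F)

/-- child relation on facts -/
def Ch (F F' : Fact Q) : Prop := ∃ j, j ≠ pp F ∧ F.2.1 j = par pp F'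

/-- skeleton nodes: facts below `f` -/
abbrev Sk : Type := {g : Fact Q // Relation.ReflTransGen (Ch pp) f g}

/-- star attachments -/
abbrev Star : Type := {x : Sk pp f × FPos Q // x.2.1.2.1 x.2.2 = par pp x.1.1 ∧ x.2.1 ≠ x.1.1}

/-- link attachments -/
abbrev Link : Type := {x : FPos Q × Sk pp f //
  x.1.2 ≠ pp x.1.1 ∧ Relation.ReflTransGen (Ch pp) f x.1.1 ∧ x.1.1.2.1 x.1.2 = par pp x.2.1}

/-- all attachments -/
abbrev Att : Type := Star pp f ⊕ Link pp f

/-- base fact of an attachment -/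
def base : Att pp f → Fact Q
  | Sum.inl x => x.1.2.1
  | Sum.inr x => x.1.1.1

/-- parent position of an attachment -/
def ppos : ∀ x : Att pp f, Fin (ar (base pp f x).1)
  | Sum.inl x => x.1.2.2
  | Sum.inr x => pp x.1.1.1

/-- parent skeleton node of an attachment -/
def node : Att pp f → Sk pp f
  | Sum.inl x => x.1.1
  | Sum.inr x => ⟨x.1.1.1, x.2.2.1⟩

/-- positions where copies of `Q` are attached -/
def IsCp : ∀ x : Att pp f, Fin (ar (base pp f x).1) → Prop
  | Sum.inl x => fun i => i ≠ x.1.2.2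
  | Sum.inr x => fun i => i ≠ x.1.1.2 ∧ i ≠ pp x.1.1.1

/-- indices of copies -/
abbrev Cp : Type := Σ x : Att pp f, {i : Fin (ar (base pp f x).1) // IsCp pp f x i}

/-- domain of the frontier structure -/
abbrev PD : Type := Sk pp f ⊕ (Cp pp f × Q.dom)

open Classical in
/-- skeleton part of a tuple -/
noncomputable def skel : ∀ x : Att pp f, Fin (ar (base pp f x).1) → Sk pp f
  | Sum.inl x => fun _ => x.1.1
  | Sum.inr x => fun i => if i = pp x.1.1.1 then ⟨x.1.1.1, x.2.2.1⟩ else x.1.2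

open Classical in
/-- the tuple of an attachment -/
noncomputable def tup (x : Att pp f) (i : Fin (ar (base pp f x).1)) : PD pp f :=
  if h : IsCp pp f x i then Sum.inr (⟨x, i, h⟩, (base pp f x).2.1 i) else Sum.inl (skel pp f x i)

/-- the facts of the frontier structure -/
noncomputable def PT : Att pp f ⊕ (Cp pp f × Fact Q) → Σ R : S, Fin (ar R) → PD pp f
  | Sum.inl x => ⟨(base pp f x).1, tup pp f x⟩
  | Sum.inr c => ⟨c.2.1, fun i => Sum.inr (c.1, c.2.2.1 i)⟩

theorem tup_cp (x : Att pp f) (i) (h : IsCp pp f x i) :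
    tup pp f x i = Sum.inr (⟨x, i, h⟩, (base pp f x).2.1 i) := dif_pos h

theorem tup_ncp (x : Att pp f) (i) (h : ¬ IsCp pp f x i) :
    tup pp f x i = Sum.inl (skel pp f x i) := dif_neg h

theorem tup_par (x : Att pp f) : tup pp f x (ppos pp f x) = Sum.inl (node pp f x) := by
  rcases x with x | x
  · exact tup_ncp pp f (Sum.inl x) x.1.2.2 (fun h => h rfl)
  · exact (tup_ncp pp f (Sum.inr x) (pp x.1.1.1) (fun h => h.2 rfl)).trans
      (congrArg Sum.inl (if_pos rfl))

theorem tup_link (x : Link pp f) : tup pp f (Sum.inr x) x.1.1.2 = Sum.inl x.1.2 :=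
  (tup_ncp pp f (Sum.inr x) x.1.1.2 (fun h => h.1 rfl)).trans (congrArg Sum.inl (if_neg x.2.1))

theorem tup_np (x : Att pp f) (j) (hj : j ≠ ppos pp f x) :
    (∃ h : IsCp pp f x j, tup pp f x j = Sum.inr (⟨x, j, h⟩, (base pp f x).2.1 j)) ∨
    ∃ l : Link pp f, (⟨x, j⟩ : Σ x : Att pp f, Fin (ar (base pp f x).1)) = ⟨Sum.inr l, l.1.1.2⟩ ∧
      tup pp f x j = Sum.inl l.1.2 := by
  by_cases h : IsCp pp f x j
  · exact Or.inl ⟨h, tup_cp pp f x j h⟩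
  · right
    rcases x with x | x
    · exact absurd hj h
    · have : j = x.1.1.2 := by
        by_contra h1
        exact h ⟨h1, hj⟩
      subst this
      exact ⟨x, rfl, tup_link pp f x⟩

/-- projection to `Q` -/
def pr : PD pp f → Q.dom
  | Sum.inl g => par pp g.1
  | Sum.inr c => c.2

theorem base_par (x : Att pp f) : (base pp f x).2.1 (ppos pp f x) = par pp (node pp f x).1 := by
  rcases x with x | x
  · exact x.2.1
  · rfl

theorem pr_tup (x : Att pp f) (j) : pr pp f (tup pp f x j) = (base pp f x).2.1 j := by
  by_cases hj : j = ppos pp f x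
  · rw [hj, tup_par, base_par]; rfl
  · rcases tup_np pp f x j hj with ⟨h, h1⟩ | ⟨l, h1, h2⟩
    · rw [h1]; rfl
    · rw [h2]
      cases h1
      exact l.2.2.2.symm

instance [Finite S] : Finite (FPos Q) := by unfold FPos; infer_instance

instance finPD [Finite S] : Finite (PD pp f) := by infer_instance

/-- frontier member -/
noncomputable def P [Finite S] : PStruct S ar 1 :=
  famS (finPD pp f) (PT pp f) (Sum.inl ⟨f, Relation.ReflTransGen.refl⟩)

theorem P_TL [Finite S] {d} (h : TL Q (Q.dist 0) d pp) (hC : Ca Q) (hf : par pp f = Q.dist 0) :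
    ∃ d' pp', TL (P pp f) ((P pp f).dist 0) d' pp' := by
  choose dd ppp hdd using fun r => exists_TL hC.2.1 hC.2.2 r
  let entry : Cp pp f → Q.dom := fun c => (base pp f c.1).2.1 c.2.1
  let dP : PD pp f → ℕ := fun e => match e with
    | Sum.inl g => d (par pp g.1)
    | Sum.inr c => d (par pp (node pp f c.1.1).1) + 1 + dd (entry c.1) c.2
  let pP : ∀ φ, Fin (ar (PT pp f φ).1) := fun φ => match φ with
    | Sum.inl x => ppos pp f x
    | Sum.inr c => ppp (entry c.1) c.2
  refine ⟨dP, famS_TL (finPD pp f) (PT pp f) _ dP pP ?_ ?_ ?_ ?_⟩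
  · rintro (x | c) j hj
    · change j ≠ ppos pp f x at hj
      change dP (tup pp f x (ppos pp f x)) < dP (tup pp f x j)
      rw [tup_par]
      rcases tup_np pp f x j hj with ⟨h1, h2⟩ | ⟨l, h1, h2⟩
      · rw [h2]
        change d (par pp (node pp f x).1) < d (par pp (node pp f x).1) + 1 + _
        omega
      · rw [h2]
        cases h1
        change d (par pp l.1.1.1) < d (par pp l.1.2.1)
        rw [← l.2.2.2]
        exact h.lt _ _ l.2.1
    · have := (hdd (entry c.1)).lt c.2 j hj
      change d (par pp (node pp f c.1.1).1) + 1 + dd (entry c.1) (c.2.2.1 (ppp (entry c.1) c.2)) <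
        d (par pp (node pp f c.1.1).1) + 1 + dd (entry c.1) (c.2.2.1 j)
      omega
  · rintro (⟨g, hg⟩ | ⟨c, e⟩) he
    · rcases Relation.ReflTransGen.cases_tail hg with rfl | ⟨g0, hg0, j, hj, hjg⟩
      · exact absurd rfl he
      · exact ⟨Sum.inl (Sum.inr ⟨(⟨g0, j⟩, ⟨g, hg⟩), hj, hg0, hjg⟩), j, hj,
          tup_link pp f ⟨(⟨g0, j⟩, ⟨g, hg⟩), hj, hg0, hjg⟩⟩
    · by_cases hce : e = entry c
      · subst hce
        obtain ⟨x, i, hi⟩ := c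
        refine ⟨Sum.inl x, i, ?_, tup_cp pp f x i hi⟩
        change i ≠ ppos pp f x
        rcases x with x | x
        · exact hi
        · exact hi.2
      · obtain ⟨F, j, hj, hje⟩ := (hdd (entry c)).ex e hce
        refine ⟨Sum.inr (c, F), j, hj, ?_⟩
        change (Sum.inr (c, F.2.1 j) : PD pp f) = _
        rw [hje]
  · have aux : ∀ x j c F k, j ≠ ppos pp f x → k ≠ ppp (entry c) F →
        tup pp f x j = Sum.inr (c, F.2.1 k) → False := by
      intro x j c F k hj hk hE
      rcases tup_np pp f x j hj with ⟨h1, h2⟩ | ⟨l, h1, h2⟩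
      · rw [h2] at hE
        have h3 := Prod.mk.inj (Sum.inr.inj hE)
        obtain ⟨h4, h5⟩ := h3
        subst h4
        exact (hdd _).root F k hk h5.symm
      · rw [h2] at hE
        cases hE
    rintro (x | c) j (x' | c') j' hj hj' hE
    · change tup pp f x j = tup pp f x' j' at hE
      have hE2 : (⟨x, j⟩ : Σ x : Att pp f, Fin (ar (base pp f x).1)) = ⟨x', j'⟩ := by
        rcases tup_np pp f x j hj with ⟨h1, h2⟩ | ⟨l, h1, h2⟩ <;>
        rcases tup_np pp f x' j' hj' with ⟨h1', h2'⟩ | ⟨l', h1', h2'⟩ <;>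
        rw [h2, h2'] at hE
        · have h3 := (Prod.mk.inj (Sum.inr.inj hE)).1
          exact congrArg (fun c : Cp pp f =>
            (⟨c.1, c.2.1⟩ : Σ x : Att pp f, Fin (ar (base pp f x).1))) h3
        · cases hE
        · cases hE
        · have h3 := Sum.inl.inj hE
          rw [h1, h1']
          have h4 := h.uniq _ _ _ _ l.2.1 l'.2.1 (by rw [l.2.2.2, l'.2.2.2, h3])
          have h5 : l = l' := Subtype.ext (Prod.ext h4 h3)
          rw [h5]
      exact congrArg (fun p : Σ x : Att pp f, Fin (ar (base pp f x).1) =>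
        (⟨Sum.inl p.1, p.2⟩ : Σ φ, Fin (ar (PT pp f φ).1))) hE2
    · exact (aux x j c'.1 c'.2 j' hj hj' hE).elim
    · exact (aux x' j' c.1 c.2 j hj' hj hE.symm).elim
    · obtain ⟨c, F⟩ := c
      obtain ⟨c', F'⟩ := c'
      change (Sum.inr (c, F.2.1 j) : PD pp f) = Sum.inr (c', F'.2.1 j') at hE
      obtain ⟨h4, h5⟩ := Prod.mk.inj (Sum.inr.inj hE)
      subst h4
      have h6 := (hdd (entry c)).uniq F j F' j' hj hj' h5
      exact congrArg (fun p : FPos Q =>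
        (⟨Sum.inr (c, p.1), p.2⟩ : Σ φ, Fin (ar (PT pp f φ).1))) h6
  · rintro (x | c) j hj hE
    · change tup pp f x j = _ at hE
      rcases tup_np pp f x j hj with ⟨h1, h2⟩ | ⟨l, h1, h2⟩
      · rw [h2] at hE
        cases hE
      · rw [h2] at hE
        have h3 := congrArg Subtype.val (Sum.inl.inj hE)
        simp only at h3
        apply h.root _ _ l.2.1
        rw [l.2.2.2, h3, hf]
    · cases hE

end constr

section main
variable [Finite S] {Q : PStruct S ar 1} (pp : ∀ F : Fact Q, Fin (ar F.1)) (f : Fact Q)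

theorem pr_hom (hf : par pp f = Q.dist 0) : IsHom (P pp f) Q (pr pp f) := by
  constructor
  · rintro R t ⟨(x | ⟨c, F⟩), hφ⟩
    · cases hφ
      have : (fun i => pr pp f (tup pp f x i)) = (base pp f x).2.1 := funext (pr_tup pp f x)
      rw [this]
      exact (base pp f x).2.2
    · cases hφ
      exact F.2.2
  · intro i
    rw [Subsingleton.elim i 0]
    exact hf

theorem sound {d} (h : TL Q (Q.dist 0) d pp) (hS : StarSurj Q) (hf : par pp f = Q.dist 0) :
    ¬ HomTo Q (P pp f) := by
  rintro ⟨u, hu⟩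
  have hσ : IsHom Q Q (fun e => pr pp f (u e)) := by
    refine ⟨fun R t ht => (pr_hom pp f hf).1 _ _ (hu.1 R t ht), fun i => ?_⟩
    simp only [hu.2 i]
    exact (pr_hom pp f hf).2 i
  have step : ∀ (g : Sk pp f) (y : Q.dom), u y = Sum.inl g →
      ∃ (g' : Sk pp f) (y' : Q.dom), u y' = Sum.inl g' ∧ d (par pp g.1) < d (par pp g'.1) := by
    rintro ⟨⟨R, tg, htg⟩, hg⟩ y hy
    obtain ⟨t, ht, h1, h2⟩ := hS _ hσ ⟨R, tg, htg⟩ (pp ⟨R, tg, htg⟩) y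
      (by simp only [hy]; rfl)
    simp only at ht h1 t
    have h2' : u (t (pp ⟨R, tg, htg⟩)) = Sum.inl ⟨⟨R, tg, htg⟩, hg⟩ := by rw [h2]; exact hy
    have h3 := hu.1 R t ht
    obtain ⟨φ, hφ⟩ := h3
    have hpt : ∀ i, pr pp f (u (t i)) = tg i := fun i => congrFun h1 i
    generalize hut : (fun i => u (t i)) = ut at hφ
    have e1 : ∀ i, u (t i) = ut i := fun i => congrFun hut i
    simp only [e1] at hpt h2'
    rcases φ with (x | ⟨c, F⟩)
    · have hR : (base pp f x).1 = R := congrArg Sigma.fst hφ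
      have hb : base pp f x = ⟨R, tg, htg⟩ := by
        clear h1 h2 e1 hut h2'
        rcases hx : base pp f x with ⟨R', t', ht'⟩
        have hpr := pr_tup pp f x
        have hφ' : (⟨(base pp f x).1, tup pp f x⟩ : Σ R : S, Fin (ar R) → PD pp f) = ⟨R, ut⟩ := hφ
        have h7 : (⟨(base pp f x).1, (base pp f x).2.1⟩ : Σ R : S, Fin (ar R) → Q.dom) =
            ⟨R, tg⟩ := by
          have h8 := congrArg (fun p : Σ R : S, Fin (ar R) → PD pp f =>
            (⟨p.1, fun i => pr pp f (p.2 i)⟩ : Σ R : S, Fin (ar R) → Q.dom)) hφ'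
          simp only at h8
          rw [funext hpr, funext hpt] at h8
          exact h8
        rw [hx] at h7
        cases h7
        rfl
      rcases x with x | x
      · exfalso
        have key : ∀ i : Fin (ar (base pp f (Sum.inl x)).1), ∀ g,
            tup pp f (Sum.inl x) i = Sum.inl g → g = x.1.1 := by
          intro i g hi
          by_cases hip : i = x.1.2.2
          · subst hip
            have := (tup_par pp f (Sum.inl x)).symm.trans hi
            exact (Sum.inl.inj this).symm
          · rw [tup_cp pp f (Sum.inl x) i hip] at hi
            cases hi
        have key2 : ∀ (X : Σ R : S, Fin (ar R) → PD pp f), PT pp f (Sum.inl (Sum.inl x)) = X →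
            ∀ i g, X.2 i = Sum.inl g → g = x.1.1 := by
          rintro X rfl
          exact key
        have := key2 _ hφ _ _ h2'
        apply x.2.2
        rw [← this]
        exact hb
      · have key2 : ∀ (X : Σ R : S, Fin (ar R) → PD pp f), PT pp f (Sum.inl (Sum.inr x)) = X →
            ∃ i, X.2 i = Sum.inl x.1.2 := by
          rintro X rfl
          exact ⟨x.1.1.2, tup_link pp f x⟩
        obtain ⟨i, hi⟩ := key2 _ hφ
        refine ⟨x.1.2, t i, (e1 i).trans hi, ?_⟩
        rw [← x.2.2.2]
        have hb' : x.1.1.1 = ⟨R, tg, htg⟩ := hb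
        have := h.lt _ _ x.2.1
        simp only
        rw [← hb']
        exact this
    · exfalso
      cases hφ
      cases h2'
  have inf : ∀ n, ∃ (g : Sk pp f) (y : Q.dom), u y = Sum.inl g ∧ n ≤ d (par pp g.1) := by
    intro n
    induction n with
    | zero => exact ⟨_, _, hu.2 0, Nat.zero_le _⟩
    | succ n ih =>
      obtain ⟨g, y, h1, h2⟩ := ih
      obtain ⟨g', y', h3, h4⟩ := step g y h1
      exact ⟨g', y', h3, by omega⟩
  obtain ⟨N, hN⟩ := (Set.finite_range d).bddAbove
  obtain ⟨g, -, -, hg⟩ := inf (N + 1)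
  have := hN ⟨par pp g.1, rfl⟩
  omega

/-- the branch of a fact can be lifted along `h` -/
inductive Good {Q' : PStruct S ar 1} (h : Q'.dom → Q.dom) : Fact Q → Q'.dom → Prop
  | mk (F : Fact Q) (y : Q'.dom) (t : Fin (ar F.1) → Q'.dom) (ht : t ∈ Q'.facts F.1)
      (hF : ∀ i, h (t i) = F.2.1 i) (hy : t (pp F) = y)
      (hg : ∀ j, j ≠ pp F → ∀ F' : Fact Q, par pp F' = F.2.1 j → Good h F' (t j)) : Good h F y

theorem complete {d} (hTL : TL Q (Q.dist 0) d pp) (Q' : PStruct S ar 1) (hC : Ca Q')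
    (h1 : HomTo Q' Q) (h2 : ¬ HomTo Q Q') : ∃ f, par pp f = Q.dist 0 ∧ HomTo Q' (P pp f) := by
  obtain ⟨h, hh⟩ := h1
  have : ∃ f : Fact Q, par pp f = Q.dist 0 ∧ ¬ Good pp h f (Q'.dist 0) := by
    by_contra hcon
    push Not at hcon
    apply h2
    apply hTL.hom (fun y y' => ∀ F : Fact Q, par pp F = y → Good pp h F y') hcon
    intro F b hb
    obtain ⟨_, _, t, ht, hF, hy, hg⟩ := hb F rfl
    refine ⟨t, ht, hy, ?_⟩
    intro j
    by_cases hj : j = pp F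
    · rw [hj, hy]; exact hb
    · exact hg j hj
  obtain ⟨f, hf, hbad⟩ := this
  refine ⟨f, hf, ?_⟩
  obtain ⟨d', pp', hTL'⟩ := exists_TL hC.2.1 hC.2.2 (Q'.dist 0)
  refine hTL'.hom (B := P pp f) (fun y' (b : PD pp f) => match b with
    | Sum.inl g => h y' = par pp g.1 ∧ ¬ Good pp h g.1 y'
    | Sum.inr c => h y' = c.2) ⟨(hh.2 0).trans hf.symm, hbad⟩ ?_
  intro F' b hb
  generalize pp' F' = i at hb
  rcases b with ⟨g, hg⟩ | ⟨c, e⟩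
  · obtain ⟨hb1, hb2⟩ := hb
    simp only at hb1 hb2
    by_cases hgF : mapFact hh F' = g
    · subst hgF
      have hi : i = pp (mapFact hh F') := by
        by_contra hne
        have := hTL.lt (mapFact hh F') i hne
        have h3 : (mapFact hh F').2.1 i = par pp (mapFact hh F') := hb1
        rw [h3] at this
        exact lt_irrefl _ this
      have : ∃ j, j ≠ pp (mapFact hh F') ∧ ∃ F2, par pp F2 = (mapFact hh F').2.1 j ∧
          ¬ Good pp h F2 (F'.2.1 j) := by
        by_contra hcon
        push Not at hcon
        apply hb2
        exact Good.mk (mapFact hh F') _ F'.2.1 F'.2.2 (fun _ => rfl) (by rw [hi]) hcon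
      obtain ⟨j, hj, F2, hF2, hbad2⟩ := this
      let l : Link pp f := ⟨(⟨mapFact hh F', j⟩, ⟨F2, hg.tail ⟨j, hj, hF2.symm⟩⟩), hj, hg, hF2.symm⟩
      have hpar : tup pp f (Sum.inr l) (pp (mapFact hh F')) = Sum.inl ⟨mapFact hh F', hg⟩ :=
        tup_par pp f (Sum.inr l)
      refine ⟨tup pp f (Sum.inr l), ⟨Sum.inl (Sum.inr l), rfl⟩, ?_, ?_⟩
      · rw [hi]; exact hpar
      · intro k
        by_cases hk : k = pp (mapFact hh F')
        · subst hk
          rw [hpar]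
          subst hi
          exact ⟨hb1, hb2⟩
        · by_cases hkj : k = j
          · subst hkj
            have := tup_link pp f l
            change tup pp f (Sum.inr l) k = _ at this
            rw [this]
            exact ⟨hF2.symm, hbad2⟩
          · have := tup_cp pp f (Sum.inr l) k ⟨hkj, hk⟩
            rw [this]
            rfl
    · let x : Star pp f := ⟨(⟨g, hg⟩, ⟨mapFact hh F', i⟩), hb1, hgF⟩
      have hpar : tup pp f (Sum.inl x) i = Sum.inl ⟨g, hg⟩ := tup_par pp f (Sum.inl x)
      refine ⟨tup pp f (Sum.inl x), ⟨Sum.inl (Sum.inl x), rfl⟩, hpar, ?_⟩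
      intro k
      by_cases hk : k = i
      · subst hk
        rw [hpar]
        exact ⟨hb1, hb2⟩
      · have := tup_cp pp f (Sum.inl x) k hk
        rw [this]
        rfl
  · simp only at hb
    refine ⟨fun k => Sum.inr (c, h (F'.2.1 k)), ⟨Sum.inr (c, mapFact hh F'), rfl⟩, ?_, ?_⟩
    · subst hb; rfl
    · intro k; rfl

theorem card_FPos (M : ℕ) (hM : ∀ R, ar R ≤ M) : Nat.card (FPos Q) ≤ size Q * M := by
  have : Function.Injective (fun o : FPos Q => ((o.1, Fin.castLE (hM _) o.2) : Fact Q × Fin M)) := by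
    rintro ⟨F, i⟩ ⟨F', i'⟩ hh
    simp only [Prod.mk.injEq] at hh
    obtain ⟨rfl, h2⟩ := hh
    have := Fin.castLE_injective _ h2
    subst this
    rfl
  have := Nat.card_le_card_of_injective _ this
  rw [Nat.card_prod, Nat.card_fin] at this
  exact this

theorem card_P (M : ℕ) (hM : ∀ R, ar R ≤ M) :
    size (P pp f) ≤ 2 * M * size Q ^ 2 + 2 * M ^ 2 * size Q ^ 3 := by
  have hO := card_FPos (Q := Q) M hM
  have hSk : Nat.card (Sk pp f) ≤ size Q :=
    Nat.card_le_card_of_injective _ Subtype.val_injective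
  have hStar : Nat.card (Star pp f) ≤ size Q * (size Q * M) := by
    refine (Nat.card_le_card_of_injective _ Subtype.val_injective).trans ?_
    rw [Nat.card_prod]
    exact Nat.mul_le_mul hSk hO
  have hLink : Nat.card (Link pp f) ≤ (size Q * M) * size Q := by
    refine (Nat.card_le_card_of_injective _ Subtype.val_injective).trans ?_
    rw [Nat.card_prod]
    exact Nat.mul_le_mul hO hSk
  have hAtt : Nat.card (Att pp f) ≤ 2 * M * size Q ^ 2 := by
    rw [Nat.card_sum]
    calc _ ≤ _ := Nat.add_le_add hStar hLink
      _ = _ := by ring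
  have hCp : Nat.card (Cp pp f) ≤ 2 * M * size Q ^ 2 * M := by
    have : Function.Injective
        (fun o : Cp pp f => ((o.1, Fin.castLE (hM _) o.2.1) : Att pp f × Fin M)) := by
      rintro ⟨F, i, hi⟩ ⟨F', i', hi'⟩ hh
      simp only [Prod.mk.injEq] at hh
      obtain ⟨rfl, h2⟩ := hh
      have := Fin.castLE_injective _ h2
      subst this
      rfl
    refine (Nat.card_le_card_of_injective _ this).trans ?_
    rw [Nat.card_prod, Nat.card_fin]
    exact Nat.mul_le_mul_right _ hAtt
  have hφ : ∀ F : Fact (P pp f), ∃ φ, PT pp f φ = ⟨F.1, F.2.1⟩ := fun F => F.2.2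
  choose φ hφ using hφ
  have hinj : Function.Injective φ := by
    intro F F' hh
    have h1 := hφ F
    rw [hh, hφ F'] at h1
    rcases F with ⟨R, t, ht⟩
    rcases F' with ⟨R', t', ht'⟩
    simp only at h1
    cases h1
    rfl
  refine (Nat.card_le_card_of_injective _ hinj).trans ?_
  rw [Nat.card_sum, Nat.card_prod]
  have h3 := Nat.mul_le_mul_right (Nat.card (Fact Q)) hCp
  have h4 : 2 * M * size Q ^ 2 * M * Nat.card (Fact Q) = 2 * M ^ 2 * size Q ^ 3 := by
    change 2 * M * size Q ^ 2 * M * size Q = _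
    ring
  omega

end main

theorem totalSize_range_le {ι : Type} [Finite ι] (g : ι → PStruct S ar 1) (E : Set (PStruct S ar 1))
    (hE : E ⊆ Set.range g) (b : ℕ) (hb : ∀ i, size (g i) ≤ b) :
    totalSize E ≤ Nat.card ι * (b + 1) := by
  have hfin : E.Finite := (Set.finite_range g).subset hE
  unfold totalSize
  rw [finsum_mem_eq_finite_toFinset_sum _ hfin]
  refine (Finset.sum_le_card_nsmul _ _ (b + 1) ?_).trans ?_
  · intro B hB
    obtain ⟨i, rfl⟩ := hE (hfin.mem_toFinset.1 hB)
    have := hb i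
    omega
  · rw [smul_eq_mul]
    refine Nat.mul_le_mul_right _ ?_
    rw [← Set.ncard_eq_toFinset_card E hfin]
    refine (Set.ncard_le_ncard hE (Set.finite_range g)).trans ?_
    rw [← Set.image_univ]
    refine (Set.ncard_image_le Set.finite_univ).trans ?_
    rw [Set.ncard_univ]

theorem main [Finite S] (M : ℕ) (hM : ∀ R, ar R ≤ M) (Q : PStruct S ar 1) (hQ : Ca Q) :
    ∃ Ep Em : Set (PStruct S ar 1), Ep.Finite ∧ Em.Finite ∧ Ep ⊆ {Q' | Ca Q'} ∧ Em ⊆ {Q' | Ca Q'} ∧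
      UniquelyCharacterizes Ep Em Q {Q' | Ca Q'} ∧
      totalSize Ep + totalSize Em ≤
        (size Q + 1) + size Q * (2 * M * size Q ^ 2 + 2 * M ^ 2 * size Q ^ 3 + 1) := by
  obtain ⟨Q0, hC0, hE, hsz, hS⟩ := exists_core Q hQ
  obtain ⟨d, pp, hTL⟩ := exists_TL hC0.2.1 hC0.2.2 (Q0.dist 0)
  let Em : Set (PStruct S ar 1) := {B | Ca B ∧ ∃ f : Fact Q0, par pp f = Q0.dist 0 ∧ P pp f = B}
  have hEm : Em ⊆ Set.range (fun f : Fact Q0 => P pp f) := by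
    rintro B ⟨-, f, -, rfl⟩
    exact ⟨f, rfl⟩
  refine ⟨{Q0}, Em, Set.finite_singleton _, (Set.finite_range _).subset hEm, ?_, ?_, ⟨⟨?_, ?_⟩, ?_⟩,
    ?_⟩
  · rintro _ rfl; exact hC0
  · rintro B hB; exact hB.1
  · rintro _ rfl; exact hE.1
  · rintro B ⟨-, f, hf, rfl⟩ hQB
    exact sound pp f hTL hS hf (HomTo.trans hE.2 hQB)
  · intro Q' hQ' hfit
    have h1 : HomTo Q' Q0 := hfit.1 Q0 rfl
    refine ⟨?_, HomTo.trans h1 hE.2⟩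
    by_contra h2
    have h3 : ¬ HomTo Q0 Q' := fun h => h2 (HomTo.trans hE.1 h)
    obtain ⟨f, hf, hhom⟩ := complete pp hTL Q' hQ' h1 h3
    refine hfit.2 (P pp f) ⟨?_, f, hf, rfl⟩ hhom
    obtain ⟨d', pp', hP⟩ := P_TL pp f hTL hC0 hf
    refine ⟨?_, fun v => ⟨0, hP.reach v⟩, hP.acyclic⟩
    intro e
    by_cases he : e = (P pp f).dist 0
    · obtain ⟨u, hu⟩ := hhom
      obtain ⟨R, t, ht, j, hj⟩ := hQ'.1 (Q'.dist 0)
      exact ⟨R, _, hu.1 R t ht, j, by rw [he, hj]; exact hu.2 0⟩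
    · obtain ⟨F, j, -, hj⟩ := hP.ex e he
      exact ⟨F.1, F.2.1, F.2.2, j, hj⟩
  · have h1 : totalSize ({Q0} : Set (PStruct S ar 1)) = size Q0 + 1 := by
      unfold totalSize
      exact finsum_mem_singleton
    have h2 := totalSize_range_le _ Em hEm _ (fun f => card_P pp f M hM)
    have h3 : Nat.card (Fact Q0) = size Q0 := rfl
    rw [h1]
    rw [h3] at h2
    refine (Nat.add_le_add_left h2 _).trans ?_
    gcongr

end Aux

/-- Every unary c-connected acyclic CQ is uniquely characterizable w.r.t. the class of
unary c-connected acyclic CQs by finitely many positive and negative examples which are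
themselves canonical structures of unary c-connected acyclic CQs; moreover these examples
can be constructed in polynomial time (in particular, of total size bounded by a fixed
polynomial). -/
theorem stmt_13 (S : Type) [Finite S] (ar : S → ℕ) :
    ∃ p : Polynomial ℕ, ∀ Q : PStruct S ar 1,
      Q ∈ {Q' : PStruct S ar 1 | IsCQ Q' ∧ CConnected Q' ∧ Acyclic Q'} →
      ∃ Ep Em : Set (PStruct S ar 1), Ep.Finite ∧ Em.Finite ∧
        Ep ⊆ {Q' : PStruct S ar 1 | IsCQ Q' ∧ CConnected Q' ∧ Acyclic Q'} ∧
        Em ⊆ {Q' : PStruct S ar 1 | IsCQ Q' ∧ CConnected Q' ∧ Acyclic Q'} ∧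
        UniquelyCharacterizes Ep Em Q
          {Q' : PStruct S ar 1 | IsCQ Q' ∧ CConnected Q' ∧ Acyclic Q'} ∧
        totalSize Ep + totalSize Em ≤ p.eval (size Q) := by
  obtain ⟨M, hM⟩ := (Set.finite_range ar).bddAbove
  refine ⟨(Polynomial.X + 1) + Polynomial.X * (Polynomial.C (2 * M) * Polynomial.X ^ 2 +
    Polynomial.C (2 * M ^ 2) * Polynomial.X ^ 3 + 1), ?_⟩
  intro Q hQ
  obtain ⟨Ep, Em, h1, h2, h3, h4, h5, h6⟩ := Aux.main M (fun R => hM ⟨R, rfl⟩) Q hQ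
  refine ⟨Ep, Em, h1, h2, h3, h4, h5, ?_⟩
  simpa only [Polynomial.eval_add, Polynomial.eval_mul, Polynomial.eval_pow, Polynomial.eval_X,
    Polynomial.eval_C, Polynomial.eval_one] using h6
end

section
/- The unary c-acyclic c-connected conjunctive query T''(x) :- R(y_1,y_2) ∧ R(y_2,y_3) ∧ R(y_3,y_4) ∧ R(y_4,y_5) ∧ ⋀_{i=1..5} R(x,y_i) (over a schema with one binary relation R) is not uniquely characterizable, with respect to the class of unary c-acyclic c-connected conjunctive queries, by any finite set of c-acyclic positive and negative examples. -/
open PStruct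

/-- The unary c-acyclic c-connected query
`T''(x) :- R(y₁,y₂) ∧ R(y₂,y₃) ∧ R(y₃,y₄) ∧ R(y₄,y₅) ∧ ⋀_{i=1..5} R(x,yᵢ)`,
represented by its canonical structure (`x = 0`, `yᵢ = i : Fin 6`),
over the schema with one binary relation. -/
def Tq'' : PStruct Unit (fun _ => 2) 1 where
  dom := Fin 6
  finite := inferInstance
  facts _ := {t | (t 0 = 1 ∧ t 1 = 2) ∨ (t 0 = 2 ∧ t 1 = 3) ∨
                  (t 0 = 3 ∧ t 1 = 4) ∨ (t 0 = 4 ∧ t 1 = 5) ∨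
                  (t 0 = 0 ∧ (t 1 = 1 ∨ t 1 = 2 ∨ t 1 = 3 ∨ t 1 = 4 ∨ t 1 = 5))}
  dist _ := 0

/-! ### Graph-theoretic helpers -/

/-- A sequence without backtracking in an acyclic graph is injective. -/
theorem injOn_of_nonbacktracking {V : Type*} {G : SimpleGraph V} (hG : G.IsAcyclic)
    (f : ℕ → V) (N : ℕ) (hadj : ∀ i < N, G.Adj (f i) (f (i + 1)))
    (hnb : ∀ i, i + 1 < N → f i ≠ f (i + 2)) :
    ∀ i ≤ N, ∀ j ≤ N, f i = f j → i = j := by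
  have key : ∀ n ≤ N, ∃ w : G.Walk (f 0) (f n),
      w.support = (List.range (n + 1)).map f ∧
      w.edges = (List.range n).map (fun i => s(f i, f (i + 1))) := by
    intro n
    induction n with
    | zero => intro _; exact ⟨SimpleGraph.Walk.nil, by simp, by simp⟩
    | succ n ih =>
      intro hn
      obtain ⟨w, h1, h2⟩ := ih (by omega)
      refine ⟨w.concat (hadj n (by omega)), ?_, ?_⟩
      · rw [SimpleGraph.Walk.support_concat, h1, List.range_succ (n := n + 1)]
        simp
      · rw [SimpleGraph.Walk.edges_concat, h2, List.range_succ (n := n)]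
        simp
  obtain ⟨w, h1, h2⟩ := key N le_rfl
  have hp : w.IsPath := by
    rw [hG.isPath_iff_isChain, h2, List.isChain_map, List.isChain_range]
    intro m hm h
    rw [Sym2.eq_iff] at h
    rcases h with ⟨h, -⟩ | ⟨h, -⟩
    · exact (hadj m (by omega)).ne h
    · exact hnb m (by omega) h
  have hnd := hp.support_nodup
  rw [h1] at hnd
  intro i hi j hj hij
  exact List.inj_on_of_nodup_map hnd (by simp; omega) (by simp; omega) hij

/-- A rank function with unique lower neighbours forces cycles through `d`. -/
theorem mem_support_of_rank {V : Type*} {G : SimpleGraph V} (d : V) (r : V → ℕ)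
    (H : ∀ v a b, v ≠ d → a ≠ d → b ≠ d → G.Adj v a → G.Adj v b → r a ≤ r v → r b ≤ r v → a = b)
    (v : V) (c : G.Walk v v) (hc : c.IsCycle) : d ∈ c.support := by
  classical
  by_contra hd
  obtain ⟨u, hu, hmax⟩ := Finset.exists_max_image c.support.toFinset r
    ⟨v, by simp⟩
  simp only [List.mem_toFinset] at hu hmax
  have hmem : ∀ x, x ∈ (c.rotate u hu).support → x ∈ c.support := fun x hx =>
    (SimpleGraph.Walk.mem_support_rotate_iff c u hu).1 hx
  have hc' : (c.rotate u hu).IsCycle := by simpa using hc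
  have e1 := hmem _ (SimpleGraph.Walk.getVert_mem_support (c.rotate u hu) 1)
  have e2 := hmem _ (SimpleGraph.Walk.getVert_mem_support (c.rotate u hu)
    ((c.rotate u hu).length - 1))
  have a1 := SimpleGraph.Walk.adj_snd hc'.not_nil
  have a2 := SimpleGraph.Walk.adj_penultimate hc'.not_nil
  refine hc'.snd_ne_penultimate (H u _ _ ?_ ?_ ?_ a1 a2.symm (hmax _ e1) (hmax _ e2))
  · rintro rfl; exact hd hu
  · intro h; exact hd (h ▸ e1)
  · intro h; exact hd (h ▸ e2)

theorem not_mem_support_of_isolated {V : Type*} {G : SimpleGraph V} (d : V)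
    (hd : ∀ w, ¬ G.Adj d w) {v : V} (c : G.Walk v v) (hc : c.IsCycle) : d ∉ c.support := by
  classical
  intro hi
  have hc' : (c.rotate d hi).IsCycle := (SimpleGraph.Walk.isCycle_rotate hi).2 hc
  exact hd _ (SimpleGraph.Walk.adj_snd hc'.not_nil)

abbrev BStruct := PStruct Unit (fun _ => 2) 1

/-- The incidence graph with the distinguished element isolated. -/
def incAway (E : BStruct) : SimpleGraph (IncV E) where
  Adj v w := (incGraph E).Adj v w ∧ v ≠ Sum.inl (E.dist 0) ∧ w ≠ Sum.inl (E.dist 0)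
  symm := by
    constructor
    rintro v w ⟨h1, h2, h3⟩
    exact ⟨h1.symm, h3, h2⟩
  loopless := by
    constructor
    rintro v ⟨h, -⟩
    exact (incGraph E).loopless.irrefl v h

theorem incAway_acyclic (E : BStruct) (hE : CAcyclic E) : (incAway E).IsAcyclic := by
  classical
  intro v c hc
  have hle : incAway E ≤ incGraph E := fun _ _ h => h.1
  obtain ⟨i, hi⟩ := hE v (c.mapLe hle) (hc.mapLe hle)
  rw [SimpleGraph.Walk.support_mapLe_eq_support] at hi
  obtain rfl : i = 0 := Subsingleton.elim _ _
  exact not_mem_support_of_isolated (G := incAway E) _ (fun w h => h.2.1 rfl) c hc hi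

def mkOcc (E : BStruct) (t : {t : Fin 2 → E.dom // t ∈ E.facts ()}) (p : Fin 2) : Occ E :=
  ⟨(), t, p⟩

def mkFact (E : BStruct) (t : {t : Fin 2 → E.dom // t ∈ E.facts ()}) : Fact E :=
  ⟨(), t⟩

/-- The walk in the incidence graph determined by a sequence of elements and facts. -/
def incSeq (E : BStruct) (v : ℕ → E.dom) (t : ℕ → {t : Fin 2 → E.dom // t ∈ E.facts ()})
    (p : ℕ → Fin 2) (i : ℕ) : IncV E :=
  if i % 4 = 0 then Sum.inl (v (i / 4))
  else if i % 4 = 1 then Sum.inr (Sum.inl (mkOcc E (t (i / 4)) (p (i / 4))))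
  else if i % 4 = 2 then Sum.inr (Sum.inr (mkFact E (t (i / 4))))
  else Sum.inr (Sum.inl (mkOcc E (t (i / 4)) (1 - p (i / 4))))

theorem inj_of_cacyclic (E : BStruct) (hE : CAcyclic E) (v : ℕ → E.dom)
    (t : ℕ → {t : Fin 2 → E.dom // t ∈ E.facts ()}) (p : ℕ → Fin 2) (N : ℕ)
    (hd : ∀ j ≤ N, v j ≠ E.dist 0)
    (h1 : ∀ j < N, (t j).1 (p j) = v j) (h2 : ∀ j < N, (t j).1 (1 - p j) = v (j + 1))
    (hne : ∀ j, j + 1 < N → t j ≠ t (j + 1)) :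
    ∀ i ≤ N, ∀ j ≤ N, v i = v j → i = j := by
  have s0 : ∀ j, incSeq E v t p (4 * j) = Sum.inl (v j) := by
    intro j
    have a : (4 * j) % 4 = 0 := by omega
    have b : (4 * j) / 4 = j := by omega
    simp [incSeq, b]
    try rfl
  have s1 : ∀ j, incSeq E v t p (4 * j + 1) = Sum.inr (Sum.inl (mkOcc E (t j) (p j))) := by
    intro j
    have a : (4 * j + 1) % 4 = 1 := by omega
    have b : (4 * j + 1) / 4 = j := by omega
    simp [incSeq, a, b]
    try rfl
  have s2 : ∀ j, incSeq E v t p (4 * j + 2) = Sum.inr (Sum.inr (mkFact E (t j))) := by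
    intro j
    have a : (4 * j + 2) % 4 = 2 := by omega
    have b : (4 * j + 2) / 4 = j := by omega
    simp [incSeq, a, b]
    try rfl
  have s3 : ∀ j, incSeq E v t p (4 * j + 3) = Sum.inr (Sum.inl (mkOcc E (t j) (1 - p j))) := by
    intro j
    have a : (4 * j + 3) % 4 = 3 := by omega
    have b : (4 * j + 3) / 4 = j := by omega
    simp [incSeq, a, b]
    try rfl
  have hinl : ∀ j ≤ N, (Sum.inl (v j) : IncV E) ≠ Sum.inl (E.dist 0) := fun j hj h =>
    hd j hj (Sum.inl.inj h)
  have key := injOn_of_nonbacktracking (incAway_acyclic E hE) (incSeq E v t p) (4 * N) ?_ ?_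
  · intro i hi j hj hij
    have := key (4 * i) (by omega) (4 * j) (by omega) (by rw [s0, s0, hij])
    omega
  · intro i hi
    obtain ⟨j, r, hr, rfl⟩ : ∃ j r, r < 4 ∧ i = 4 * j + r :=
      ⟨i / 4, i % 4, by omega, by omega⟩
    have hj : j < N := by omega
    interval_cases r
    · rw [add_zero, s0, s1]
      refine ⟨⟨mkOcc E (t j) (p j), Or.inl ⟨?_, rfl⟩⟩, hinl j hj.le, Sum.inr_ne_inl⟩
      rw [← h1 j hj]; rfl
    · rw [s1, s2]
      exact ⟨⟨mkOcc E (t j) (p j), Or.inr (Or.inr (Or.inl ⟨rfl, rfl⟩))⟩,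
        Sum.inr_ne_inl, Sum.inr_ne_inl⟩
    · rw [s2, s3]
      exact ⟨⟨mkOcc E (t j) (1 - p j), Or.inr (Or.inr (Or.inr ⟨rfl, rfl⟩))⟩,
        Sum.inr_ne_inl, Sum.inr_ne_inl⟩
    · rw [s3, show 4 * j + 3 + 1 = 4 * (j + 1) by ring, s0]
      refine ⟨⟨mkOcc E (t j) (1 - p j), Or.inr (Or.inl ⟨?_, rfl⟩)⟩, Sum.inr_ne_inl, hinl _ hj⟩
      rw [← h2 j hj]; rfl
  · intro i hi
    obtain ⟨j, r, hr, rfl⟩ : ∃ j r, r < 4 ∧ i = 4 * j + r :=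
      ⟨i / 4, i % 4, by omega, by omega⟩
    interval_cases r
    · rw [add_zero, s0, s2]
      exact Sum.inl_ne_inr
    · rw [s1, s3]
      intro h
      have h' := Sum.inl.inj (Sum.inr.inj h)
      have h'' : p j = 1 - p j := congrArg (fun o : Occ E => o.2.2) h'
      revert h''
      generalize p j = q
      revert q
      decide
    · rw [s2, show 4 * j + 2 + 2 = 4 * (j + 1) by ring, s0]
      exact Sum.inr_ne_inl
    · rw [s3, show 4 * j + 3 + 2 = 4 * (j + 1) + 1 by ring, s1]
      intro h
      have h' := Sum.inl.inj (Sum.inr.inj h)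
      have h3 := eq_of_heq (Sigma.mk.inj h').2
      have h'' : t j = t (j + 1) := (Prod.mk.inj h3).1
      exact hne j (by omega) h''

/-! ### The queries -/

/-- The edge relation of the caterpillar. -/
def cEdge (k l : ℕ) : Prop :=
  (k % 8 = 3 ∧ l = k + 5) ∨ (k % 8 = 0 ∧ l = k + 1) ∨ (k % 8 = 2 ∧ l + 1 = k) ∨
  (k % 8 = 3 ∧ l + 1 = k) ∨ (k % 8 = 4 ∧ l + 4 = k) ∨ (k % 8 = 5 ∧ l + 1 = k) ∨
  (k % 8 = 2 ∧ l = k + 4) ∨ (k % 8 = 6 ∧ l = k + 1)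

/-- The level of a vertex, shifted by one. -/
def cLev (k : ℕ) : Fin 6 :=
  if k % 8 = 0 then 3 else if k % 8 = 1 then 4 else if k % 8 = 2 then 3 else
  if k % 8 = 3 then 2 else if k % 8 = 4 then 2 else if k % 8 = 5 then 1 else
  if k % 8 = 6 then 4 else 5

/-- A potential with four values that increases along edges. -/
def cPot (k : ℕ) : ℕ :=
  if k % 8 = 0 then 2 else if k % 8 = 1 then 3 else if k % 8 = 2 then 1 else
  if k % 8 = 3 then 0 else if k % 8 = 4 then 1 else if k % 8 = 5 then 0 else
  if k % 8 = 6 then 2 else 3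

theorem cPot_lt {k l : ℕ} (h : cEdge k l) : cPot k < cPot l := by
  unfold cEdge at h
  unfold cPot
  split_ifs <;> omega

theorem cPot_le (k : ℕ) : cPot k ≤ 3 := by
  unfold cPot
  split_ifs <;> omega

theorem cEdge_max {k l k' l' : ℕ} (h : cEdge k l) (h' : cEdge k' l')
    (hm : max k l = max k' l') : k = k' ∧ l = l' := by
  unfold cEdge at h h'
  omega

theorem cEdge_ne {k l : ℕ} (h : cEdge k l) : k ≠ l := by
  unfold cEdge at h
  omega

def Qn (N : ℕ) : BStruct where
  dom := Option (Fin N)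
  finite := inferInstance
  facts _ := {t | (t 0 = none ∧ ∃ k, t 1 = some k) ∨
    ∃ k l : Fin N, t 0 = some k ∧ t 1 = some l ∧ cEdge k l}
  dist _ := none

theorem Qn_isCQ (N : ℕ) (hN : 0 < N) : IsCQ (Qn N) := by
  have key : ∀ k : Fin N, (![none, some k] : Fin 2 → Option (Fin N)) ∈ (Qn N).facts () :=
    fun k => Or.inl ⟨rfl, k, rfl⟩
  intro x
  match x with
  | none => exact ⟨(), _, key ⟨0, hN⟩, 0, rfl⟩
  | some k => exact ⟨(), _, key k, 1, rfl⟩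

theorem inc_reach (E : BStruct) (t : {t : Fin 2 → E.dom // t ∈ E.facts ()}) (p : Fin 2) :
    (incGraph E).Adj (Sum.inl (t.1 p)) (Sum.inr (Sum.inl (mkOcc E t p))) ∧
    (incGraph E).Adj (Sum.inr (Sum.inl (mkOcc E t p))) (Sum.inr (Sum.inr (mkFact E t))) :=
  ⟨⟨mkOcc E t p, Or.inl ⟨rfl, rfl⟩⟩, ⟨mkOcc E t p, Or.inr (Or.inr (Or.inl ⟨rfl, rfl⟩))⟩⟩

theorem Qn_cconnected (N : ℕ) : CConnected (Qn N) := by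
  have hel : ∀ x : (Qn N).dom, (incGraph (Qn N)).Reachable (Sum.inl none) (Sum.inl x) := by
    intro x
    match x with
    | none => exact SimpleGraph.Reachable.refl _
    | some k =>
      have key : (![none, some k] : Fin 2 → Option (Fin N)) ∈ (Qn N).facts () :=
        Or.inl ⟨rfl, k, rfl⟩
      have a := inc_reach (Qn N) ⟨_, key⟩ 0
      have b := inc_reach (Qn N) ⟨_, key⟩ 1
      exact a.1.reachable.trans (a.2.reachable.trans (b.2.symm.reachable.trans b.1.symm.reachable))
  intro v
  refine ⟨0, ?_⟩
  match v with
  | Sum.inl x => exact hel x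
  | Sum.inr (Sum.inl ⟨(), t, p⟩) =>
    exact (hel (t.1 p)).trans (inc_reach (Qn N) t p).1.reachable
  | Sum.inr (Sum.inr ⟨(), t⟩) =>
    have a := inc_reach (Qn N) t 0
    exact (hel (t.1 0)).trans (a.1.reachable.trans a.2.reachable)

theorem adj_elem {E : BStruct} {x : E.dom} {w : IncV E}
    (h : (incGraph E).Adj (Sum.inl x) w) :
    ∃ t p, t.1 p = x ∧ w = Sum.inr (Sum.inl (mkOcc E t p)) := by
  obtain ⟨⟨⟨⟩, t, p⟩, h | h | h | h⟩ := h
  · exact ⟨t, p, (Sum.inl.inj h.1).symm, h.2⟩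
  · exact absurd h.2 Sum.inl_ne_inr
  · exact absurd h.1 Sum.inl_ne_inr
  · exact absurd h.2 Sum.inl_ne_inr

theorem adj_occ {E : BStruct} {t : {t : Fin 2 → E.dom // t ∈ E.facts ()}} {p : Fin 2} {w : IncV E}
    (h : (incGraph E).Adj (Sum.inr (Sum.inl (mkOcc E t p))) w) :
    w = Sum.inl (t.1 p) ∨ w = Sum.inr (Sum.inr (mkFact E t)) := by
  obtain ⟨o, h | h | h | h⟩ := h
  · exact absurd h.1 Sum.inr_ne_inl
  · have := Sum.inl.inj (Sum.inr.inj h.2)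
    subst this
    exact Or.inl h.1
  · have := Sum.inl.inj (Sum.inr.inj h.1)
    subst this
    exact Or.inr h.2
  · exact absurd (Sum.inr.inj h.2) Sum.inl_ne_inr

theorem adj_fact {E : BStruct} {t : {t : Fin 2 → E.dom // t ∈ E.facts ()}} {w : IncV E}
    (h : (incGraph E).Adj (Sum.inr (Sum.inr (mkFact E t))) w) :
    ∃ p, w = Sum.inr (Sum.inl (mkOcc E t p)) := by
  obtain ⟨⟨⟨⟩, s, p⟩, h | h | h | h⟩ := h
  · exact absurd h.1 Sum.inr_ne_inl
  · exact absurd (Sum.inr.inj h.2) Sum.inr_ne_inl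
  · exact absurd (Sum.inr.inj h.1) Sum.inr_ne_inl
  · have h2 : mkFact E t = mkFact E s := Sum.inr.inj (Sum.inr.inj h.2)
    have h3 : t = s := by
      have := (Sigma.mk.inj h2).2
      exact eq_of_heq this
    subst h3
    exact ⟨p, h.1⟩

def optVal {N : ℕ} : Option (Fin N) → ℕ
  | none => 0
  | some k => k

def factRank {N : ℕ} (t : Fin 2 → Option (Fin N)) : ℕ :=
  if t 0 = none then 4 * optVal (t 1) + 6 else 4 * max (optVal (t 0)) (optVal (t 1)) + 2

def occRank {N : ℕ} (t : Fin 2 → Option (Fin N)) (p : Fin 2) : ℕ :=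
  if t 0 = none then (if p = 1 then 4 * optVal (t 1) + 5 else 4 * optVal (t 1) + 7)
  else if optVal (t p) = max (optVal (t 0)) (optVal (t 1)) then
    4 * max (optVal (t 0)) (optVal (t 1)) + 3
  else 4 * max (optVal (t 0)) (optVal (t 1)) + 1

def qRank (N : ℕ) : IncV (Qn N) → ℕ
  | Sum.inl x => 4 * optVal x + 4
  | Sum.inr (Sum.inl o) => occRank o.2.1.1 o.2.2
  | Sum.inr (Sum.inr f) => factRank f.2.1

theorem Qn_cacyclic (N : ℕ) : CAcyclic (Qn N) := by
  intro v c hc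
  refine ⟨0, mem_support_of_rank (Sum.inl none) (qRank N) ?_ v c hc⟩
  intro v a b hv ha hb hva hvb ra rb
  match v with
  | Sum.inl none => exact absurd rfl hv
  | Sum.inl (some m) =>
    obtain ⟨t, p, htp, rfl⟩ := adj_elem hva
    obtain ⟨s, q, hsq, rfl⟩ := adj_elem hvb
    have key : ∀ (t : {t : Fin 2 → (Qn N).dom // t ∈ (Qn N).facts ()}) (p : Fin 2),
        t.1 p = some m → occRank t.1 p ≤ 4 * (m : ℕ) + 4 →
        ∃ k l : Fin N, t.1 = ![some k, some l] ∧ cEdge k l ∧ max (k : ℕ) l = m ∧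
          ((p = 0 ∧ (l : ℕ) < k) ∨ (p = 1 ∧ (k : ℕ) < l)) := by
      rintro ⟨t, ht⟩ p htp hr
      simp only at htp hr
      rcases ht with ⟨h0, k, h1⟩ | ⟨k, l, h0, h1, hkl⟩
      · fin_cases p
        · change t 0 = some m at htp
          rw [h0] at htp
          exact absurd htp (by simp)
        · change t 1 = some m at htp
          simp [occRank, h0, htp, optVal] at hr
      · have hne := cEdge_ne hkl
        refine ⟨k, l, ?_, hkl, ?_⟩
        · funext i
          fin_cases i
          · exact h0
          · exact h1
        · fin_cases p
          · change t 0 = some m at htp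
            rw [h0] at htp
            obtain rfl := Option.some.inj htp
            simp only [occRank, h0, h1, optVal] at hr
            simp at hr ⊢
            split_ifs at hr <;> omega
          · change t 1 = some m at htp
            rw [h1] at htp
            obtain rfl := Option.some.inj htp
            simp only [occRank, h0, h1, optVal] at hr
            simp [h1] at hr ⊢
            split_ifs at hr <;> omega
    obtain ⟨k, l, e1, c1, m1, o1⟩ := key t p htp ra
    obtain ⟨k', l', e2, c2, m2, o2⟩ := key s q hsq rb
    obtain ⟨e3, e4⟩ := cEdge_max c1 c2 (m1.trans m2.symm)
    have e3 : k = k' := Fin.ext e3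
    have e4 : l = l' := Fin.ext e4
    subst e3 e4
    have hts : t = s := Subtype.ext (e1.trans e2.symm)
    have hpq : p = q := by
      rcases o1 with ⟨rfl, h⟩ | ⟨rfl, h⟩ <;> rcases o2 with ⟨rfl, h'⟩ | ⟨rfl, h'⟩ <;>
        first | rfl | omega
    rw [hts, hpq]
  | Sum.inr (Sum.inl ⟨(), t, p⟩) =>
    have main : ∀ w w' : IncV (Qn N), w = Sum.inl (t.1 p) → w' = Sum.inr (Sum.inr (mkFact _ t)) →
        w ≠ Sum.inl none → qRank N w ≤ occRank t.1 p → qRank N w' ≤ occRank t.1 p → False := by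
      rintro w w' rfl rfl hw h1 h2
      change 4 * optVal (t.1 p) + 4 ≤ _ at h1
      change factRank t.1 ≤ _ at h2
      have hw' : t.1 p ≠ none := fun h => hw (congrArg Sum.inl h)
      clear hw hva hvb ra rb hv
      obtain ⟨t, ht⟩ := t
      simp only at hw' h1 h2
      unfold factRank at h2
      unfold occRank at h1 h2
      rcases ht with ⟨h0, k, h3⟩ | ⟨k, l, h0, h3, hkl⟩
      · fin_cases p
        · exact hw' h0
        · simp [h0] at h2
      · have hne := cEdge_ne hkl
        simp [h0] at h1 h2
        split_ifs at h1 h2 <;> omega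
    rcases adj_occ hva with h1 | h1 <;> rcases adj_occ hvb with h2 | h2
    · rw [h1, h2]
    · exact (main a b h1 h2 ha ra rb).elim
    · exact (main b a h2 h1 hb rb ra).elim
    · rw [h1, h2]
  | Sum.inr (Sum.inr ⟨(), t⟩) =>
    obtain ⟨p, rfl⟩ := adj_fact hva
    obtain ⟨q, rfl⟩ := adj_fact hvb
    have main : ∀ p q : Fin 2, p = 0 → q = 1 → occRank t.1 p ≤ factRank t.1 →
        occRank t.1 q ≤ factRank t.1 → False := by
      rintro p q rfl rfl h1 h2
      clear hva hvb ra rb hv ha hb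
      obtain ⟨t, ht⟩ := t
      simp only at h1 h2
      unfold factRank at h1 h2
      unfold occRank at h1 h2
      rcases ht with ⟨h0, k, h3⟩ | ⟨k, l, h0, h3, hkl⟩
      · simp [h0] at h1
      · have hne := cEdge_ne hkl
        simp [h0, h3, optVal] at h1 h2
        split_ifs at h1 h2 <;> omega
    have hp : p = 0 ∨ p = 1 := by omega
    have hq : q = 0 ∨ q = 1 := by omega
    rcases hp with hp | hp <;> rcases hq with hq | hq
    · rw [hp, hq]
    · exact (main p q hp hq ra rb).elim
    · exact (main q p hq hp rb ra).elim
    · rw [hp, hq]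

theorem Qn_to_T (N : ℕ) : HomTo (Qn N) Tq'' := by
  refine ⟨fun x => match x with
    | none => (0 : Fin 6)
    | some k => cLev k, ?_, fun _ => rfl⟩
  rintro ⟨⟩ t ht
  rcases ht with ⟨h0, k, h1⟩ | ⟨k, l, h0, h1, hkl⟩
  · refine Or.inr (Or.inr (Or.inr (Or.inr ⟨?_, ?_⟩)))
    · simp only [h0]
    · simp only [h1]
      unfold cLev
      split_ifs <;> decide
  · change (_ ∨ _)
    simp only [h0, h1]
    have e : ∀ c : ℕ, c < 8 → ∀ m, m % 8 = c → cLev m = cLev c := by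
      intro c hc m hm
      have : c % 8 = c := by omega
      simp only [cLev, hm, this]
    unfold cEdge at hkl
    rcases hkl with h | h | h | h | h | h | h | h
    · rw [e 3 (by omega) k h.1, e 0 (by omega) l (by omega)]; decide
    · rw [e 0 (by omega) k h.1, e 1 (by omega) l (by omega)]; decide
    · rw [e 2 (by omega) k h.1, e 1 (by omega) l (by omega)]; decide
    · rw [e 3 (by omega) k h.1, e 2 (by omega) l (by omega)]; decide
    · rw [e 4 (by omega) k h.1, e 0 (by omega) l (by omega)]; decide
    · rw [e 5 (by omega) k h.1, e 4 (by omega) l (by omega)]; decide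
    · rw [e 2 (by omega) k h.1, e 6 (by omega) l (by omega)]; decide
    · rw [e 6 (by omega) k h.1, e 7 (by omega) l (by omega)]; decide

/-- Binary facts. -/
def BR (E : BStruct) (a b : E.dom) : Prop := (![a, b] : Fin 2 → E.dom) ∈ E.facts ()

theorem hom_BR {A B : BStruct} {h : A.dom → B.dom} (hh : IsHom A B h) {a b : A.dom}
    (hab : BR A a b) : BR B (h a) (h b) := by
  have := hh.1 () _ hab
  have e : (fun i => h ((![a, b] : Fin 2 → A.dom) i)) = ![h a, h b] := by
    funext i
    fin_cases i <;> rfl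
  unfold BR
  rw [← e]
  exact this

theorem T_to (E : BStruct) (d y1 y2 y3 y4 y5 : E.dom) (hd : E.dist 0 = d)
    (h1 : BR E d y1) (h2 : BR E d y2) (h3 : BR E d y3) (h4 : BR E d y4) (h5 : BR E d y5)
    (h12 : BR E y1 y2) (h23 : BR E y2 y3) (h34 : BR E y3 y4) (h45 : BR E y4 y5) :
    HomTo Tq'' E := by
  let g : Fin 6 → E.dom := ![d, y1, y2, y3, y4, y5]
  refine ⟨g, ?_, ?_⟩
  · rintro ⟨⟩ t ht
    have e : (fun i => g (t i)) = ![g (t 0), g (t 1)] := by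
      funext i
      fin_cases i <;> rfl
    rw [e]
    rcases ht with ⟨a, b⟩ | ⟨a, b⟩ | ⟨a, b⟩ | ⟨a, b⟩ | ⟨a, b | b | b | b | b⟩ <;> rw [a, b]
    exacts [h12, h23, h34, h45, h1, h2, h3, h4, h5]
  · intro i
    obtain rfl : i = 0 := Subsingleton.elim _ _
    exact hd.symm

theorem BR_T {i j : Fin 6} (h : (i = 1 ∧ j = 2) ∨ (i = 2 ∧ j = 3) ∨ (i = 3 ∧ j = 4) ∨
    (i = 4 ∧ j = 5) ∨ (i = 0 ∧ (j = 1 ∨ j = 2 ∨ j = 3 ∨ j = 4 ∨ j = 5))) : BR Tq'' i j := h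

theorem not_T_to_Qn (N : ℕ) : ¬ HomTo Tq'' (Qn N) := by
  rintro ⟨h, hh⟩
  have h0 : h (0 : Fin 6) = none := hh.2 0
  have hx : ∀ i : Fin 6, BR Tq'' (0 : Fin 6) i → ∃ k : Fin N, h i = some k := by
    intro i hi
    have := hom_BR hh hi
    rw [h0] at this
    rcases this with ⟨-, k, hk⟩ | ⟨k, l, hk, -⟩
    · exact ⟨k, hk⟩
    · exact absurd hk (by simp)
  have hy : ∀ i j : Fin 6, BR Tq'' i j → ∀ k l : Fin N, h i = some k → h j = some l →
      cPot k < cPot l := by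
    intro i j hij k l hk hl
    have := hom_BR hh hij
    rw [hk, hl] at this
    rcases this with ⟨hk', -⟩ | ⟨k', l', hk', hl', he⟩
    · exact absurd hk' (by simp)
    · obtain rfl := Option.some.inj hk'
      obtain rfl := Option.some.inj hl'
      exact cPot_lt he
  obtain ⟨k1, e1⟩ := hx 1 (BR_T (by decide))
  obtain ⟨k2, e2⟩ := hx 2 (BR_T (by decide))
  obtain ⟨k3, e3⟩ := hx 3 (BR_T (by decide))
  obtain ⟨k4, e4⟩ := hx 4 (BR_T (by decide))
  obtain ⟨k5, e5⟩ := hx 5 (BR_T (by decide))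
  have a1 := hy 1 2 (BR_T (by decide)) _ _ e1 e2
  have a2 := hy 2 3 (BR_T (by decide)) _ _ e2 e3
  have a3 := hy 3 4 (BR_T (by decide)) _ _ e3 e4
  have a4 := hy 4 5 (BR_T (by decide)) _ _ e4 e5
  have := cPot_le k5
  omega

theorem spine_edge0 (j : ℕ) (h : j % 4 = 0 ∨ j % 4 = 3) :
    cEdge (8 * (j / 4) + j % 4) (8 * ((j + 1) / 4) + (j + 1) % 4) := by
  unfold cEdge
  rcases h with h | h
  · have a : (j + 1) / 4 = j / 4 := by omega
    have b : (j + 1) % 4 = 1 := by omega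
    rw [h, a, b]
    generalize j / 4 = i
    right; left; omega
  · have a : (j + 1) / 4 = j / 4 + 1 := by omega
    have b : (j + 1) % 4 = 0 := by omega
    rw [h, a, b]
    generalize j / 4 = i
    left; omega

theorem spine_edge1 (j : ℕ) (h : ¬ (j % 4 = 0 ∨ j % 4 = 3)) :
    cEdge (8 * ((j + 1) / 4) + (j + 1) % 4) (8 * (j / 4) + j % 4) := by
  unfold cEdge
  have h : j % 4 = 1 ∨ j % 4 = 2 := by omega
  have a : (j + 1) / 4 = j / 4 := by omega
  rcases h with h | h
  · have b : (j + 1) % 4 = 2 := by omega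
    rw [h, a, b]
    generalize j / 4 = i
    right; right; left; omega
  · have b : (j + 1) % 4 = 3 := by omega
    rw [h, a, b]
    generalize j / 4 = i
    right; right; right; left; omega

set_option maxHeartbeats 1000000 in
theorem Qn_not_to (E : BStruct) (hE : CAcyclic E) (hT : ¬ HomTo Tq'' E) (n : ℕ)
    (hn : Nat.card E.dom < n) : ¬ HomTo (Qn (8 * n)) E := by
  rintro ⟨h, hh⟩
  have hdist : h none = E.dist 0 := hh.2 0
  let H : ℕ → E.dom := fun k => if hk : k < 8 * n then h (some ⟨k, hk⟩) else E.dist 0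
  have hH : ∀ k (hk : k < 8 * n), H k = h (some ⟨k, hk⟩) := fun k hk => dif_pos hk
  have hR : ∀ k l, k < 8 * n → l < 8 * n → cEdge k l → BR E (H k) (H l) := by
    intro k l hk hl hkl
    rw [hH k hk, hH l hl]
    exact hom_BR hh (Or.inr ⟨⟨k, hk⟩, ⟨l, hl⟩, rfl, rfl, hkl⟩)
  have hD : ∀ k, k < 8 * n → BR E (E.dist 0) (H k) := by
    intro k hk
    rw [hH k hk, ← hdist]
    exact hom_BR hh (Or.inl ⟨rfl, ⟨k, hk⟩, rfl⟩)
  have noloop : ∀ y, BR E (E.dist 0) y → BR E y y → False := fun y h1 h2 =>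
    hT (T_to E _ y y y y y rfl h1 h1 h1 h1 h1 h2 h2 h2 h2)
  have hHd : ∀ k, k < 8 * n → H k ≠ E.dist 0 := by
    intro k hk e
    have := hD k hk
    rw [e] at this
    exact noloop _ this this
  have hab : ∀ k l, k % 8 = 0 → l % 8 = 2 → k + 5 < 8 * n → l + 5 < 8 * n → H k ≠ H l := by
    intro k l hk hl hk' hl' e
    have e1 := hR (k + 5) (k + 4) (by omega) (by omega) (by unfold cEdge; omega)
    have e2 := hR (k + 4) k (by omega) (by omega) (by unfold cEdge; omega)
    have e3 := hR l (l + 4) (by omega) (by omega) (by unfold cEdge; omega)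
    have e4 := hR (l + 4) (l + 5) (by omega) (by omega) (by unfold cEdge; omega)
    rw [← e] at e3
    exact hT (T_to E _ _ _ _ _ _ rfl (hD (k + 5) (by omega)) (hD (k + 4) (by omega))
      (hD k (by omega)) (hD (l + 4) (by omega)) (hD (l + 5) (by omega)) e1 e2 e3 e4)
  have hedge : ∀ k l, k < 8 * n → l < 8 * n → cEdge k l → H k ≠ H l := by
    intro k l hk hl hkl e
    have := hR k l hk hl hkl
    rw [e] at this
    exact noloop _ (hD l hl) this
  let v : ℕ → E.dom := fun j => H (8 * (j / 4) + j % 4)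
  have hv : ∀ i r, r < 4 → v (4 * i + r) = H (8 * i + r) := by
    intro i r hr
    have a : (4 * i + r) / 4 = i := by omega
    have b : (4 * i + r) % 4 = r := by omega
    simp only [v, a, b]
  let p : ℕ → Fin 2 := fun j => if j % 4 = 0 ∨ j % 4 = 3 then 0 else 1
  have hp0 : ∀ j, (j % 4 = 0 ∨ j % 4 = 3) → p j = 0 := fun j hj => if_pos hj
  have hp1 : ∀ j, ¬ (j % 4 = 0 ∨ j % 4 = 3) → p j = 1 := fun j hj => if_neg hj
  have ht : ∀ j, ∃ t : {t : Fin 2 → E.dom // t ∈ E.facts ()}, j < 4 * n - 1 →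
      ((j % 4 = 0 ∨ j % 4 = 3) → t.1 = ![v j, v (j + 1)]) ∧
      (¬ (j % 4 = 0 ∨ j % 4 = 3) → t.1 = ![v (j + 1), v j]) := by
    intro j
    by_cases hj : j < 4 * n - 1
    · by_cases hc : j % 4 = 0 ∨ j % 4 = 3
      · have : BR E (v j) (v (j + 1)) :=
          hR _ _ (by omega) (by omega) (spine_edge0 j hc)
        exact ⟨⟨_, this⟩, fun _ => ⟨fun _ => rfl, fun h => absurd hc h⟩⟩
      · have : BR E (v (j + 1)) (v j) :=
          hR _ _ (by omega) (by omega) (spine_edge1 j hc)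
        exact ⟨⟨_, this⟩, fun _ => ⟨fun h => absurd h hc, fun _ => rfl⟩⟩
    · exact ⟨⟨_, hD 0 (by omega)⟩, fun h => absurd h hj⟩
  choose t ht using ht
  have inj := inj_of_cacyclic E hE v t p (4 * n - 1) ?_ ?_ ?_ ?_
  · have hf : Function.Injective (fun j : Fin (4 * n) => v j) := by
      intro i j hij
      exact Fin.ext (inj i (by omega) j (by omega) hij)
    have := Nat.card_le_card_of_injective _ hf
    rw [Nat.card_fin] at this
    omega
  · intro j hj
    exact hHd _ (by omega)
  · intro j hj
    by_cases hc : j % 4 = 0 ∨ j % 4 = 3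
    · rw [hp0 j hc, (ht j hj).1 hc]; rfl
    · rw [hp1 j hc, (ht j hj).2 hc]; rfl
  · intro j hj
    by_cases hc : j % 4 = 0 ∨ j % 4 = 3
    · rw [hp0 j hc, (ht j hj).1 hc]; rfl
    · rw [hp1 j hc, (ht j hj).2 hc]; rfl
  · intro j hj e
    have h1 := ht j (by omega)
    have h2 := ht (j + 1) hj
    rw [← e] at h2
    obtain ⟨i, r, hr, rfl⟩ : ∃ i r, r < 4 ∧ j = 4 * i + r :=
      ⟨j / 4, j % 4, by omega, by omega⟩
    interval_cases r
    · have e1 := congrFun ((h1.1 (by omega)).symm.trans (h2.2 (by omega))) 0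
      change v (4 * i + 0) = v (4 * i + 2) at e1
      rw [hv _ _ (by omega), hv _ _ (by omega)] at e1
      exact hab _ _ (by omega) (by omega) (by omega) (by omega) e1
    · have e1 := congrFun ((h1.2 (by omega)).symm.trans (h2.2 (by omega))) 0
      change v (4 * i + 2) = v (4 * i + 3) at e1
      rw [hv _ _ (by omega), hv _ _ (by omega)] at e1
      exact hedge _ _ (by omega) (by omega) (by unfold cEdge; omega) e1.symm
    · have e1 := congrFun ((h1.2 (by omega)).symm.trans (h2.1 (by omega))) 1
      change v (4 * i + 2) = v (4 * (i + 1) + 0) at e1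
      rw [hv _ _ (by omega), hv _ _ (by omega)] at e1
      exact hab _ _ (by omega) (by omega) (by omega) (by omega) e1.symm
    · have e1 := congrFun ((h1.1 (by omega)).symm.trans (h2.1 (by omega))) 0
      change v (4 * i + 3) = v (4 * (i + 1) + 0) at e1
      rw [hv _ _ (by omega), hv _ _ (by omega)] at e1
      exact hedge _ _ (by omega) (by omega) (by unfold cEdge; omega) e1

theorem HomTo_trans {A B C : BStruct} (h1 : HomTo A B) (h2 : HomTo B C) : HomTo A C := by
  obtain ⟨f, hf⟩ := h1
  obtain ⟨g, hg⟩ := h2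
  refine ⟨g ∘ f, fun R t ht => hg.1 R _ (hf.1 R t ht), fun i => ?_⟩
  change g (f _) = _
  rw [hf.2, hg.2]

/-- The query `T''` is not uniquely characterizable, w.r.t. the class of unary c-acyclic
c-connected CQs, by any finite set of c-acyclic positive and negative examples. -/
theorem stmt_16 :
    ¬ ∃ Ep Em : Set (PStruct Unit (fun _ => 2) 1),
        Ep.Finite ∧ Em.Finite ∧ (∀ E ∈ Ep ∪ Em, CAcyclic E) ∧
        UniquelyCharacterizes Ep Em Tq''
          {Q : PStruct Unit (fun _ => 2) 1 | IsCQ Q ∧ CAcyclic Q ∧ CConnected Q} := by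
  rintro ⟨Ep, Em, -, hEm, hac, ⟨hpos, hneg⟩, huniq⟩
  obtain ⟨m, hm⟩ := (hEm.image (fun E : BStruct => Nat.card E.dom)).bddAbove
  have hfit : Fits (Qn (8 * (m + 1))) Ep Em := by
    refine ⟨fun E hE => HomTo_trans (Qn_to_T _) (hpos E hE), fun E hE => ?_⟩
    have hle : Nat.card E.dom ≤ m := hm ⟨E, hE, rfl⟩
    exact Qn_not_to E (hac E (Or.inr hE)) (hneg E hE) (m + 1) (by omega)
  exact not_T_to_Qn _ (huniq _ ⟨Qn_isCQ _ (by omega), Qn_cacyclic _, Qn_cconnected _⟩ hfit).1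
end
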